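/- Let p0, p1, p2 ∈ R_{2,1} have no common zeros on P^1 × P^1 and be generic, and let I = ⟨p0, p1, p2⟩. Then I has the minimal bigraded free resolution 0 → R(−6,−3) → R(−4,−3)^3 ⊕ R(−6,−2)^2 → R(−6,−1) ⊕ R(−4,−2)^3 ⊕ R(−3,−3)^2 → R(−2,−1)^3 → I → 0. Concretely: there exist a 3×6 matrix M1, a 6×5 matrix M2, and a 5×1 matrix M3 over R such that, assigning to the rows of M1 the bidegrees (2,1), (2,1), (2,1), to the columns of M1 (= rows of M2) the bidegrees (6,1), (4,2), (4,2), (4,2), (3,3), (3,3), to the columns of M2 (= rows of M3) the bidegrees (4,3), (4,3), (4,3), (6,2), (6,2), and to the column of M3 the bidegree (6,3), every matrix entry is bihomogeneous of bidegree equal to its column bidegree minus its row bidegree (and is 0 whenever this difference has a negative coordinate), and the complex 0 → R →(M3) R^5 →(M2) R^6 →(M1) R^3 →(A ↦ A0 p0 + A1 p1 + A2 p2) R is exact at R^5, R^6, and R^3, the map M3 is injective, and the image of the last map is I. -/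

import Mathlib

open MvPolynomial

noncomputable section

/-- The bigraded polynomial ring `R = k[x,y,z,w]`; variables `0,1,2,3` are `x,y,z,w`. -/
abbrev Rk (k : Type*) [Field k] := MvPolynomial (Fin 4) k

/-- The bigrading: `x, y` have degree `(1,0)`; `z, w` have degree `(0,1)`. -/
def bidegWt : Fin 4 → ℤ × ℤ := ![(1, 0), (1, 0), (0, 1), (0, 1)]

/-- `p` is bihomogeneous of bidegree `(m, n)` (with the convention that only the zero
polynomial is bihomogeneous of a bidegree with a negative coordinate). -/
def Bihom {k : Type*} [Field k] (p : Rk k) (m n : ℤ) : Prop :=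
  p.IsWeightedHomogeneous bidegWt (m, n)

/-- `p0, p1, p2` have no common zeros on `ℙ¹ × ℙ¹`. -/
def NoCommonZeros {k : Type*} [Field k] (p0 p1 p2 : Rk k) : Prop :=
  ∀ a b c d : k, (a, b) ≠ (0, 0) → (c, d) ≠ (0, 0) →
    eval ![a, b, c, d] p0 ≠ 0 ∨ eval ![a, b, c, d] p1 ≠ 0 ∨ eval ![a, b, c, d] p2 ≠ 0

/-- The map `(A0, A1, A2) ↦ A0 p0 + A1 p1 + A2 p2`, as a `k`-linear map on `R³`. -/
def syzMapk {k : Type*} [Field k] (p : Fin 3 → Rk k) : (Fin 3 → Rk k) →ₗ[k] Rk k :=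
  ∑ i : Fin 3, (LinearMap.mulRight k (p i)).comp (LinearMap.proj i)

/-- The bigraded piece `Syz(p)_{m,n}`: triples `(A0, A1, A2)` of bihomogeneous polynomials of
bidegree `(m-2, n-1)` with `A0 p0 + A1 p1 + A2 p2 = 0`, as a `k`-subspace of `R³`. -/
def SyzPiece {k : Type*} [Field k] (p : Fin 3 → Rk k) (m n : ℤ) :
    Submodule k (Fin 3 → Rk k) :=
  (Submodule.pi Set.univ fun _ => weightedHomogeneousSubmodule k bidegWt (m - 2, n - 1)) ⊓
    LinearMap.ker (syzMapk p)

/-- The syzygy module `Syz(p)`, as an `R`-submodule of `R³`. -/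
def Syz {k : Type*} [Field k] (p : Fin 3 → Rk k) : Submodule (Rk k) (Fin 3 → Rk k) :=
  LinearMap.ker (∑ i : Fin 3, (LinearMap.mulRight (Rk k) (p i)).comp (LinearMap.proj i))

/-- The Koszul submodule of `R³`: the `R`-submodule generated by the three Koszul syzygies
`(p1, −p0, 0)`, `(p2, 0, −p0)`, `(0, p2, −p1)`. -/
def KoszulSub {k : Type*} [Field k] (p0 p1 p2 : Rk k) : Submodule (Rk k) (Fin 3 → Rk k) :=
  Submodule.span (Rk k) {![p1, -p0, 0], ![p2, 0, -p0], ![0, p2, -p1]}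

/-- `p0, p1, p2 ∈ R_{2,1}` are generic: only finitely many points `[a0 : a1 : a2]` of `ℙ²(k)`
are such that `a0 p0 + a1 p1 + a2 p2` factors as `q · l` with `q ∈ R_{2,0}`, `l ∈ R_{0,1}`. -/
def BidegGeneric {k : Type*} [Field k] (p0 p1 p2 : Rk k) : Prop :=
  {P : Projectivization k (Fin 3 → k) |
    ∃ q l : Rk k, Bihom q 2 0 ∧ Bihom l 0 1 ∧
      P.rep 0 • p0 + P.rep 1 • p1 + P.rep 2 • p2 = q * l}.Finite

/-- Bidegrees of the columns of `M1` (= rows of `M2`) in the generic resolution: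
`(6,1), (4,2), (4,2), (4,2), (3,3), (3,3)`. -/
def genColDeg1 : Fin 6 → ℤ × ℤ := ![(6, 1), (4, 2), (4, 2), (4, 2), (3, 3), (3, 3)]

/-- Bidegrees of the columns of `M2` (= rows of `M3`) in the generic resolution:
`(4,3), (4,3), (4,3), (6,2), (6,2)`. -/
def genColDeg2 : Fin 5 → ℤ × ℤ := ![(4, 3), (4, 3), (4, 3), (6, 2), (6, 2)]

namespace Rk

variable {k : Type*} [Field k]

section Divisibility

theorem dvd_of_dvd_mul_of_isRelPrime {d f u v : Rk k} (huv : IsRelPrime u v) (hu : u ≠ 0)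
    (h1 : d ∣ f * u) (h2 : d ∣ f * v) : d ∣ f := by
  obtain ⟨c1, e1⟩ := h1
  obtain ⟨c2, e2⟩ := h2
  by_cases hd : d = 0
  · subst hd
    have : f * u = 0 := by rw [e1, zero_mul]
    rcases mul_eq_zero.mp this with h | h
    · exact h ▸ dvd_refl _
    · exact absurd h hu
  have key : c1 * v = c2 * u := mul_left_cancel₀ hd (by linear_combination -v * e1 + u * e2)
  obtain ⟨c, rfl⟩ : u ∣ c1 := huv.dvd_of_dvd_mul_right ⟨c2, by rw [key, mul_comm]⟩
  exact ⟨c, mul_right_cancel₀ hu (by linear_combination e1)⟩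

theorem isRelPrime_X {i j : Fin 4} (h : i ≠ j) : IsRelPrime (X i : Rk k) (X j) :=
  (X_prime.irreducible.isRelPrime_iff_not_dvd).2 fun hd => h (X_dvd_X.1 hd)

theorem isRelPrime_X_pow {i j : Fin 4} (h : i ≠ j) (m n : ℕ) :
    IsRelPrime ((X i : Rk k) ^ m) (X j ^ n) :=
  (isRelPrime_X h).pow

theorem exists_of_X_mul_eq {i j : Fin 4} (h : i ≠ j) {f g : Rk k} (e : X i * f = X j * g) :
    ∃ q, f = X j * q ∧ g = X i * q := by
  obtain ⟨q, rfl⟩ : X j ∣ f :=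
    (isRelPrime_X h.symm).dvd_of_dvd_mul_left ⟨g, e⟩
  exact ⟨q, rfl, mul_left_cancel₀ (X_ne_zero j) (by linear_combination -e)⟩

/-- Divisibility by `d` can be tested after multiplication by the elements of a set that
generates an ideal containing powers of two distinct variables. -/
theorem dvd_of_forall_dvd_mul {s : Set (Rk k)} {i j : Fin 4} (h : i ≠ j)
    (hi : X i ∈ (Ideal.span s).radical) (hj : X j ∈ (Ideal.span s).radical) {d f : Rk k}
    (hd : ∀ u ∈ s, d ∣ f * u) : d ∣ f := by
  have hd' : ∀ u ∈ Ideal.span s, d ∣ f * u := fun u hu => by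
    induction hu using Submodule.span_induction with
    | mem u hu => exact hd u hu
    | zero => simp
    | add u v _ _ hu hv => rw [mul_add]; exact dvd_add hu hv
    | smul c u _ hu => rw [smul_eq_mul, mul_left_comm]; exact hu.mul_left c
  obtain ⟨m, hm⟩ := hi
  obtain ⟨n, hn⟩ := hj
  exact dvd_of_dvd_mul_of_isRelPrime (isRelPrime_X_pow h m n) (pow_ne_zero _ (X_ne_zero i))
    (hd' _ hm) (hd' _ hn)

end Divisibility

section Substitution

/-- Specialization of `x, y` to constants. -/
def substXY (s t : k) : Rk k →ₐ[k] Rk k := aeval ![C s, C t, X 2, X 3]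

/-- Specialization of `z, w` to zero. -/
def substZW : Rk k →ₐ[k] Rk k := aeval ![X 0, X 1, 0, 0]

theorem sub_map_mem {I : Ideal (Rk k)} (φ : Rk k →ₐ[k] Rk k) (h : ∀ i, X i - φ (X i) ∈ I)
    (f : Rk k) : f - φ f ∈ I := by
  have : Ideal.Quotient.mkₐ k I = (Ideal.Quotient.mkₐ k I).comp φ :=
    MvPolynomial.algHom_ext fun i => Ideal.Quotient.eq.2 (h i)
  exact Ideal.Quotient.eq.1 (DFunLike.congr_fun this f)

theorem exists_of_substXY_eq_zero {f : Rk k} (h : substXY 0 0 f = 0) :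
    ∃ f0 f1, f = X 0 * f0 + X 1 * f1 := by
  have := sub_map_mem (I := Ideal.span {X 0, X 1}) (substXY (0 : k) 0) (fun i => by
    fin_cases i <;> simp [substXY, Ideal.mem_span_pair]
    · exact ⟨1, 0, by ring⟩
    · exact ⟨0, 1, by ring⟩) f
  obtain ⟨f0, f1, e⟩ := Ideal.mem_span_pair.1 this
  exact ⟨f0, f1, by rw [h] at e; linear_combination -e⟩

theorem exists_of_substZW_eq_zero {f : Rk k} (h : substZW f = 0) :
    ∃ f0 f1, f = X 2 * f0 + X 3 * f1 := by
  have := sub_map_mem (I := Ideal.span {X 2, X 3}) (substZW (k := k)) (fun i => by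
    fin_cases i <;> simp [substZW, Ideal.mem_span_pair]
    · exact ⟨1, 0, by ring⟩
    · exact ⟨0, 1, by ring⟩) f
  obtain ⟨f0, f1, e⟩ := Ideal.mem_span_pair.1 this
  exact ⟨f0, f1, by rw [h] at e; linear_combination -e⟩

end Substitution

section Grading

/-- The weight measuring the degree in `x, y`. -/
def wtXY : Fin 4 → ℕ := ![1, 1, 0, 0]

attribute [local instance] MvPolynomial.weightedGradedAlgebra

theorem weight_wtXY (d : Fin 4 →₀ ℕ) : Finsupp.weight wtXY d = d 0 + d 1 := by
  simp [Finsupp.weight_apply, Finsupp.sum_fintype, Fin.sum_univ_four, wtXY]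

theorem substXY_eq_self {f : Rk k} (hf : f.IsWeightedHomogeneous wtXY 0) (s t : k) :
    substXY s t f = f := by
  induction hf using IsWeightedHomogeneous.induction_on with
  | zero => simp
  | add _ _ _ _ h1 h2 => rw [map_add, h1, h2]
  | monomial d r hd =>
    have h0 : d 0 = 0 ∧ d 1 = 0 := by
      rw [weight_wtXY] at hd; omega
    rw [substXY, monomial_eq, map_mul, Finsupp.prod_fintype _ _ (by simp)]
    simp [Fin.prod_univ_four, h0]

theorem exists_of_isWeightedHomogeneous_succ {f : Rk k} {n : ℕ}
    (hf : f.IsWeightedHomogeneous wtXY (n + 1)) :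
    ∃ f0 f1 : Rk k, f0.IsWeightedHomogeneous wtXY n ∧ f1.IsWeightedHomogeneous wtXY n ∧
      f = X 0 * f0 + X 1 * f1 := by
  induction hf using IsWeightedHomogeneous.induction_on with
  | zero => exact ⟨0, 0, isWeightedHomogeneous_zero .., isWeightedHomogeneous_zero .., by simp⟩
  | add _ _ _ _ h1 h2 =>
    obtain ⟨f0, f1, a0, a1, rfl⟩ := h1
    obtain ⟨g0, g1, b0, b1, rfl⟩ := h2
    exact ⟨f0 + g0, f1 + g1, a0.add b0, a1.add b1, by ring⟩
  | monomial d r hd =>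
    rw [weight_wtXY] at hd
    have key : ∀ i : Fin 4, wtXY i = 1 → d i ≠ 0 →
        (monomial (d - Finsupp.single i 1) r).IsWeightedHomogeneous wtXY n ∧
          monomial d r = X i * monomial (d - Finsupp.single i 1) r := by
      intro i hi hdi
      have hsum : Finsupp.single i 1 + (d - Finsupp.single i 1) = d :=
        add_tsub_cancel_of_le (Finsupp.single_le_iff.2 (Nat.one_le_iff_ne_zero.2 hdi))
      refine ⟨isWeightedHomogeneous_monomial _ _ _ ?_, ?_⟩
      · have := congrArg (Finsupp.weight wtXY) hsum
        rw [map_add, weight_wtXY d, hd, Finsupp.weight_single, hi] at this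
        simp at this
        omega
      · rw [X, monomial_mul, one_mul, hsum]
    by_cases h0 : d 0 = 0
    · obtain ⟨h, e⟩ := key 1 rfl (by omega)
      exact ⟨0, _, isWeightedHomogeneous_zero .., h, by rw [← e]; ring⟩
    · obtain ⟨h, e⟩ := key 0 rfl h0
      exact ⟨_, 0, h, isWeightedHomogeneous_zero .., by rw [← e]; ring⟩

theorem isWeightedHomogeneous_of_mul {f g : Rk k} {m n : ℕ} (hg : g ≠ 0)
    (hgm : g.IsWeightedHomogeneous wtXY m) (h : (f * g).IsWeightedHomogeneous wtXY (n + m)) :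
    f.IsWeightedHomogeneous wtXY n := by
  have := DirectSum.coe_decompose_mul_add_of_right_mem
    (weightedHomogeneousSubmodule k wtXY) (a := f) (i := n) hgm
  rw [DirectSum.decompose_of_mem_same _ h] at this
  rw [mul_right_cancel₀ hg this]
  exact (DirectSum.decompose (weightedHomogeneousSubmodule k wtXY) f n).2

theorem eq_zero_of_isWeightedHomogeneous_mul {f g : Rk k} {m n : ℕ} (hmn : n < m)
    (hgm : g.IsWeightedHomogeneous wtXY m) (h : (f * g).IsWeightedHomogeneous wtXY n) :
    f * g = 0 := by
  have := DirectSum.coe_decompose_mul_of_right_mem_of_not_le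
    (weightedHomogeneousSubmodule k wtXY) (a := f) (n := n) hgm (by omega)
  rwa [DirectSum.decompose_of_mem_same _ h] at this

end Grading

end Rk

open Matrix

section Triples

variable {S : Type*} [CommRing S]

/-- The determinant of the matrix with columns `N 0, N 1, N 2`. -/
def colDet (N : Fin 3 → Fin 3 → S) : S := N 0 ⬝ᵥ (N 1 ⨯₃ N 2)

/-- The rows of the adjugate of the matrix with columns `N 0, N 1, N 2`. -/
def adjRow (N : Fin 3 → Fin 3 → S) : Fin 3 → Fin 3 → S :=
  ![N 1 ⨯₃ N 2, N 2 ⨯₃ N 0, N 0 ⨯₃ N 1]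

/-- The value at the `i`-th column of the adjugate of the quadratic form defining the conic of
all `(x², xy, y²)`. -/
def adjConic (N : Fin 3 → Fin 3 → S) (i : Fin 3) : S :=
  adjRow N 1 i ^ 2 - adjRow N 0 i * adjRow N 2 i

theorem map_cross {T : Type*} [CommRing T] (φ : S →+* T) (u v : Fin 3 → S) (i : Fin 3) :
    φ ((u ⨯₃ v) i) = ((φ ∘ u) ⨯₃ (φ ∘ v)) i := by
  fin_cases i <;> simp [cross_apply]

theorem map_adjRow {T : Type*} [CommRing T] (φ : S →+* T) (N : Fin 3 → Fin 3 → S)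
    (j i : Fin 3) : φ (adjRow N j i) = adjRow (fun j i => φ (N j i)) j i := by
  fin_cases j <;> exact map_cross φ _ _ i

theorem map_colDet {T : Type*} [CommRing T] (φ : S →+* T) (N : Fin 3 → Fin 3 → S) :
    φ (colDet N) = colDet fun j i => φ (N j i) := by
  simp [colDet, cross_apply, dotProduct, Fin.sum_univ_three]

theorem map_adjConic {T : Type*} [CommRing T] (φ : S →+* T) (N : Fin 3 → Fin 3 → S)
    (i : Fin 3) : φ (adjConic N i) = adjConic (fun j i => φ (N j i)) i := by
  simp [adjConic, map_adjRow]

theorem colDet_mul (N : Fin 3 → Fin 3 → S) (f : Fin 3 → S) (i : Fin 3) :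
    colDet N * f i = ∑ j, (N j ⬝ᵥ f) * adjRow N j i := by
  fin_cases i <;>
    simp [colDet, adjRow, cross_apply, dotProduct, Fin.sum_univ_three] <;> ring

theorem colDet_mul' (N : Fin 3 → Fin 3 → S) (f : Fin 3 → S) (i : Fin 3) :
    colDet N * f i = ∑ j, N j i * (adjRow N j ⬝ᵥ f) := by
  fin_cases i <;>
    simp [colDet, adjRow, cross_apply, dotProduct, Fin.sum_univ_three] <;> ring

theorem colDet_mul_of_sum (N : Fin 3 → Fin 3 → S) (q u : Fin 3 → S) (d : S)
    (h : ∀ i, ∑ j, N j i * q j = d * u i) (j : Fin 3) :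
    colDet N * q j = d * (adjRow N j ⬝ᵥ u) := by
  have h0 := h 0
  have h1 := h 1
  have h2 := h 2
  simp only [Fin.sum_univ_three] at h0 h1 h2
  fin_cases j <;>
    simp [colDet, adjRow, cross_apply, dotProduct, Fin.sum_univ_three]
  · linear_combination (N 1 1 * N 2 2 - N 1 2 * N 2 1) * h0 +
      (N 1 2 * N 2 0 - N 1 0 * N 2 2) * h1 + (N 1 0 * N 2 1 - N 1 1 * N 2 0) * h2
  · linear_combination (N 2 1 * N 0 2 - N 2 2 * N 0 1) * h0 +
      (N 2 2 * N 0 0 - N 2 0 * N 0 2) * h1 + (N 2 0 * N 0 1 - N 2 1 * N 0 0) * h2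
  · linear_combination (N 0 1 * N 1 2 - N 0 2 * N 1 1) * h0 +
      (N 0 2 * N 1 0 - N 0 0 * N 1 2) * h1 + (N 0 0 * N 1 1 - N 0 1 * N 1 0) * h2

theorem sum_mul_adjRow (N : Fin 3 → Fin 3 → S) (i l : Fin 3) :
    ∑ j, N j i * adjRow N j l = if i = l then colDet N else 0 := by
  fin_cases i <;> fin_cases l <;>
    simp [colDet, adjRow, cross_apply, dotProduct, Fin.sum_univ_three] <;> ring

theorem dot_comb_cross (N : Fin 3 → Fin 3 → S) (m u t : Fin 3 → S)
    (h : ∀ i, ((fun i => ∑ j, m j * N j i) ⨯₃ u) i + ∑ j, t j * adjRow N j i = 0) :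
    colDet N * t 0 = m 2 * (adjRow N 1 ⬝ᵥ u) - m 1 * (adjRow N 2 ⬝ᵥ u) ∧
    colDet N * t 1 = m 0 * (adjRow N 2 ⬝ᵥ u) - m 2 * (adjRow N 0 ⬝ᵥ u) ∧
    colDet N * t 2 = m 1 * (adjRow N 0 ⬝ᵥ u) - m 0 * (adjRow N 1 ⬝ᵥ u) := by
  have h0 := h 0
  have h1 := h 1
  have h2 := h 2
  simp [adjRow, cross_apply, Fin.sum_univ_three] at h0 h1 h2
  simp [colDet, adjRow, cross_apply, dotProduct, Fin.sum_univ_three]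
  refine ⟨?_, ?_, ?_⟩
  · linear_combination N 0 0 * h0 + N 0 1 * h1 + N 0 2 * h2
  · linear_combination N 1 0 * h0 + N 1 1 * h1 + N 1 2 * h2
  · linear_combination N 2 0 * h0 + N 2 1 * h1 + N 2 2 * h2

end Triples

namespace Rk

variable {k : Type*} [Field k] (a b : Fin 3 → Fin 3 → k)

/-- The linear form `(a j i) z + (b j i) w`, the `j`-th coefficient of the `i`-th generator as a
quadratic form in `x, y`. -/
def pencil (j i : Fin 3) : Rk k := C (a j i) * X 2 + C (b j i) * X 3

/-- The triple of quadratic forms in `x, y` with coefficients `a`. -/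
def quad (i : Fin 3) : Rk k :=
  C (a 0 i) * X 0 ^ 2 + C (a 1 i) * (X 0 * X 1) + C (a 2 i) * X 1 ^ 2

/-- The triple of forms of bidegree `(2, 1)` with coefficients `a, b`. -/
def biform (i : Fin 3) : Rk k := X 2 * quad a i + X 3 * quad b i

/-- The monomials of degree two in `x, y`. -/
def quadMon : Fin 3 → Rk k := ![X 0 ^ 2, X 0 * X 1, X 1 ^ 2]

/-- The first syzygy of bidegree `(3, 3)`. -/
def adjSyz₀ (i : Fin 3) : Rk k :=
  X 1 * adjRow (pencil a b) 0 i - X 0 * adjRow (pencil a b) 1 i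

/-- The second syzygy of bidegree `(3, 3)`. -/
def adjSyz₁ (i : Fin 3) : Rk k :=
  X 1 * adjRow (pencil a b) 1 i - X 0 * adjRow (pencil a b) 2 i

/-- The first syzygy matrix. -/
def syz₁ : Matrix (Fin 3) (Fin 6) (Rk k) :=
  ![![(quad a ⨯₃ quad b) 0, 0, -biform a b 2, biform a b 1, adjSyz₀ a b 0, adjSyz₁ a b 0],
    ![(quad a ⨯₃ quad b) 1, biform a b 2, 0, -biform a b 0, adjSyz₀ a b 1, adjSyz₁ a b 1],
    ![(quad a ⨯₃ quad b) 2, -biform a b 1, biform a b 0, 0, adjSyz₀ a b 2, adjSyz₁ a b 2]]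

/-- The second syzygy matrix. -/
def syz₂ : Matrix (Fin 6) (Fin 5) (Rk k) :=
  ![![0, 0, 0, X 3, -X 2],
    ![pencil a b 0 0, pencil a b 1 0, pencil a b 2 0, quad a 0, quad b 0],
    ![pencil a b 0 1, pencil a b 1 1, pencil a b 2 1, quad a 1, quad b 1],
    ![pencil a b 0 2, pencil a b 1 2, pencil a b 2 2, quad a 2, quad b 2],
    ![0, X 1, -X 0, 0, 0],
    ![-X 1, X 0, 0, 0, 0]]

/-- The third syzygy matrix. -/
def syz₃ : Matrix (Fin 5) (Fin 1) (Rk k) :=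
  ![![X 0 ^ 2], ![X 0 * X 1], ![X 1 ^ 2], ![-X 2], ![-X 3]]

theorem biform_eq : biform a b = fun i => ∑ j, quadMon j * pencil a b j i := by
  funext i
  simp [biform, quad, pencil, quadMon, Fin.sum_univ_three]
  ring

theorem syz₁_mulVec (v : Fin 6 → Rk k) (i : Fin 3) :
    (syz₁ a b).mulVec v i = v 0 * (quad a ⨯₃ quad b) i +
      (biform a b ⨯₃ ![v 1, v 2, v 3]) i + v 4 * adjSyz₀ a b i + v 5 * adjSyz₁ a b i := by
  fin_cases i <;>
    simp [syz₁, mulVec, dotProduct, Fin.sum_univ_six, cross_apply] <;> ring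

theorem syz₂_mulVec (v : Fin 5 → Rk k) :
    (syz₂ a b).mulVec v = ![X 3 * v 3 - X 2 * v 4,
      ∑ j, pencil a b j 0 * ![v 0, v 1, v 2] j + quad a 0 * v 3 + quad b 0 * v 4,
      ∑ j, pencil a b j 1 * ![v 0, v 1, v 2] j + quad a 1 * v 3 + quad b 1 * v 4,
      ∑ j, pencil a b j 2 * ![v 0, v 1, v 2] j + quad a 2 * v 3 + quad b 2 * v 4,
      X 1 * v 1 - X 0 * v 2, X 0 * v 1 - X 1 * v 0] := by
  funext i
  fin_cases i <;>
    simp [syz₂, mulVec, dotProduct, Fin.sum_univ_five, Fin.sum_univ_three] <;> ring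

theorem syz₃_mulVec (u : Fin 1 → Rk k) :
    syz₃.mulVec u = ![X 0 ^ 2 * u 0, X 0 * X 1 * u 0, X 1 ^ 2 * u 0, -X 2 * u 0, -X 3 * u 0] := by
  funext i
  fin_cases i <;> simp [syz₃, mulVec, dotProduct]

theorem syz₃_mulVec_injective : Function.Injective fun u : Fin 1 → Rk k => syz₃.mulVec u := by
  intro u v h
  funext i
  rw [Subsingleton.elim i 0]
  have := congrFun h 3
  simp only [syz₃_mulVec] at this
  exact mul_left_cancel₀ (neg_ne_zero.2 (X_ne_zero (2 : Fin 4))) this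

theorem syz₂_mulVec_syz₃_mulVec (u : Fin 1 → Rk k) :
    (syz₂ a b).mulVec (syz₃.mulVec u) = 0 := by
  rw [syz₃_mulVec, syz₂_mulVec]
  funext i
  fin_cases i <;> simp [Fin.sum_univ_three, pencil, quad] <;> ring

theorem syz₁_mulVec_syz₂_mulVec (u : Fin 5 → Rk k) :
    (syz₁ a b).mulVec ((syz₂ a b).mulVec u) = 0 := by
  rw [syz₂_mulVec]
  funext i
  rw [syz₁_mulVec]
  fin_cases i <;>
    simp [Fin.sum_univ_three, pencil, quad, biform, adjSyz₀, adjSyz₁, adjRow, cross_apply] <;>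
    ring

theorem sum_syz₁_mulVec_mul_biform (u : Fin 6 → Rk k) :
    ∑ i, (syz₁ a b).mulVec u i * biform a b i = 0 := by
  simp only [Fin.sum_univ_three, syz₁_mulVec]
  simp [pencil, quad, biform, adjSyz₀, adjSyz₁, adjRow, cross_apply]
  ring

variable {a b}

theorem exists_eq_syz₃_mulVec {i : Fin 3} (hp : biform a b i ≠ 0) {v : Fin 5 → Rk k}
    (h : (syz₂ a b).mulVec v = 0) : ∃ u : Fin 1 → Rk k, v = syz₃.mulVec u := by
  rw [syz₂_mulVec] at h
  have e0 := congrFun h 0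
  have e4 := congrFun h 4
  have e5 := congrFun h 5
  have eu : ∑ j, pencil a b j i * ![v 0, v 1, v 2] j + quad a i * v 3 + quad b i * v 4 = 0 := by
    fin_cases i
    · exact congrFun h 1
    · exact congrFun h 2
    · exact congrFun h 3
  simp at e0 e4 e5
  obtain ⟨h', h3, h4⟩ := exists_of_X_mul_eq (i := (3 : Fin 4)) (j := 2) (by decide)
    (sub_eq_zero.1 e0)
  obtain ⟨q, h1, h2⟩ := exists_of_X_mul_eq (i := (1 : Fin 4)) (j := 0) (by decide)
    (sub_eq_zero.1 e4)
  obtain ⟨q', h1', h0⟩ := exists_of_X_mul_eq (i := (0 : Fin 4)) (j := 1) (by decide)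
    (sub_eq_zero.1 e5)
  obtain ⟨r, hq, hq'⟩ := exists_of_X_mul_eq (i := (0 : Fin 4)) (j := 1) (by decide)
    (h1.symm.trans h1')
  subst hq hq'
  have key : biform a b i * (r + h') = 0 := by
    rw [← eu, h0, h1, h2, h3, h4]
    simp [biform, quad, pencil, Fin.sum_univ_three]
    ring
  have hr : h' = -r := by
    rw [eq_neg_iff_add_eq_zero, add_comm]
    exact (mul_eq_zero.1 key).resolve_left hp
  refine ⟨fun _ => r, ?_⟩
  rw [syz₃_mulVec]
  funext l
  fin_cases l <;> simp [h0, h1, h2, h3, h4, hr] <;> ring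

end Rk

namespace Rk

variable {k : Type*} [Field k] {a b : Fin 3 → Fin 3 → k}

theorem substXY_pencil (s t : k) (j i : Fin 3) :
    substXY s t (pencil a b j i) = pencil a b j i := by
  simp [substXY, pencil, algHom_C]

theorem substXY_colDet (s t : k) :
    substXY s t (colDet (pencil a b)) = colDet (pencil a b) := by
  have := map_colDet (substXY s t : Rk k →ₐ[k] Rk k).toRingHom (pencil a b)
  simpa [substXY_pencil] using this

theorem substXY_adjRow (s t : k) (j i : Fin 3) :
    substXY s t (adjRow (pencil a b) j i) = adjRow (pencil a b) j i := by
  have := map_adjRow (substXY s t : Rk k →ₐ[k] Rk k).toRingHom (pencil a b) j i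
  simpa [substXY_pencil] using this

theorem substZW_quad (i : Fin 3) : substZW (quad a i) = quad a i := by
  simp [substZW, quad, algHom_C]

theorem substZW_pencil (j i : Fin 3) : substZW (pencil a b j i) = 0 := by
  simp [substZW, pencil]

theorem substZW_biform (i : Fin 3) : substZW (biform a b i) = 0 := by
  simp [substZW, biform]

theorem substZW_adjSyz (i : Fin 3) :
    substZW (adjSyz₀ a b i) = 0 ∧ substZW (adjSyz₁ a b i) = 0 := by
  have h : ∀ j, substZW (adjRow (pencil a b) j i) = 0 := fun j => by
    have := map_adjRow (substZW (k := k)).toRingHom (pencil a b) j i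
    simp only [AlgHom.toRingHom_eq_coe, RingHom.coe_coe, substZW_pencil] at this
    rw [this]
    fin_cases j <;> fin_cases i <;> simp [adjRow]
  simp [adjSyz₀, adjSyz₁, h]

theorem substZW_biform_cross (u : Fin 3 → Rk k) (i : Fin 3) :
    substZW ((biform a b ⨯₃ u) i) = 0 := by
  fin_cases i <;> simp [cross_apply, substZW_biform]

theorem X_mul_cross (i : Fin 3) :
    X 2 * (quad a ⨯₃ quad b) i = (biform a b ⨯₃ quad b) i ∧
      X 3 * (quad a ⨯₃ quad b) i = (quad a ⨯₃ biform a b) i := by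
  fin_cases i <;> constructor <;> simp [cross_apply, biform] <;> ring

theorem dvd_cross {S : Type*} [CommRing S] {d f : S} {u v : Fin 3 → S}
    (h : ∀ i, d ∣ f * u i) (i : Fin 3) : d ∣ f * (u ⨯₃ v) i := by
  have key : ∀ i j, d ∣ f * (u i * v j) := fun i j => by
    rw [← mul_assoc]; exact (h i).mul_right _
  fin_cases i <;> simp only [cross_apply] <;> simp [mul_sub] <;>
    exact dvd_sub (key _ _) (key _ _)

theorem dvd_of_dvd_mul_biform
    (hg0 : X 0 ∈ (Ideal.span (Set.range (quad a ⨯₃ quad b))).radical)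
    (hg1 : X 1 ∈ (Ideal.span (Set.range (quad a ⨯₃ quad b))).radical)
    {d f : Rk k} (h : ∀ i, d ∣ f * biform a b i) : d ∣ f := by
  refine dvd_of_forall_dvd_mul (by decide) hg0 hg1 ?_
  rintro _ ⟨i, rfl⟩
  refine dvd_of_dvd_mul_of_isRelPrime (isRelPrime_X (i := (2 : Fin 4)) (j := 3) (by decide))
    (X_ne_zero _) ?_ ?_
  · rw [mul_assoc, mul_comm _ (X 2), (X_mul_cross i).1]
    exact dvd_cross h i
  · rw [mul_assoc, mul_comm _ (X 3), (X_mul_cross i).2, ← cross_anticomm, Pi.neg_apply, mul_neg,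
      dvd_neg]
    exact dvd_cross h i

/-- If `r` satisfies the two Koszul relations of the conic modulo `D`, then modulo `D` it lies
on the cone over the conic. -/
theorem exists_eq_add_quadMon_mul {D : Rk k} (hD : D ≠ 0) (hfix : substXY 0 0 D = D)
    {r : Fin 3 → Rk k} {t0 t1 : Rk k} (e0 : D * t0 = X 1 * r 1 - X 0 * r 2)
    (e1 : D * t1 = X 0 * r 1 - X 1 * r 0) :
    ∃ (v : Fin 3 → Rk k) (h : Rk k), (∀ j, r j = D * v j + quadMon j * h) ∧
      t0 = X 1 * v 1 - X 0 * v 2 ∧ t1 = X 0 * v 1 - X 1 * v 0 := by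
  have hzero : ∀ t f g : Rk k, D * t = X 0 * f + X 1 * g →
      ∃ f' g', t = X 0 * f' + X 1 * g' := fun t f g e => by
    refine exists_of_substXY_eq_zero ((mul_eq_zero.1 ?_).resolve_left hD)
    rw [← hfix, ← map_mul, e]
    simp [substXY]
  obtain ⟨t00, t01, rfl⟩ := hzero t0 (-r 2) (r 1) (by linear_combination e0)
  obtain ⟨t10, t11, rfl⟩ := hzero t1 (r 1) (-r 0) (by linear_combination e1)
  obtain ⟨h1, E0, E1⟩ := exists_of_X_mul_eq (i := (0 : Fin 4)) (j := 1) (by decide)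
    (f := D * t00 + r 2) (g := r 1 - D * t01) (by linear_combination e0)
  obtain ⟨h2, E2, E3⟩ := exists_of_X_mul_eq (i := (0 : Fin 4)) (j := 1) (by decide)
    (f := D * t10 - r 1) (g := - r 0 - D * t11) (by linear_combination e1)
  obtain ⟨s1, s2, es⟩ := hzero (t01 - t10) (-h1) (-h2) (by linear_combination -E1 - E2)
  obtain ⟨h3, E4, E5⟩ := exists_of_X_mul_eq (i := (0 : Fin 4)) (j := 1) (by decide)
    (f := D * s1 + h1) (g := -(D * s2 + h2)) (by linear_combination -D * es - E1 - E2)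
  refine ⟨![X 0 * s2 - t11, t01 - X 0 * s1, -(t00 + X 1 * s1)], h3, fun j => ?_, ?_, ?_⟩
  · fin_cases j <;> simp [quadMon]
    · linear_combination -E3 + X 0 * E5
    · linear_combination E1 + X 0 * E4
    · linear_combination E0 + X 1 * E4
  · simp
    ring
  · simp
    linear_combination -X 0 * es

theorem exists_eq_of_cross_add_adjSyz (hD : colDet (pencil a b) ≠ 0)
    (hcop : ∀ f, (∀ i, colDet (pencil a b) ∣ f * biform a b i) → colDet (pencil a b) ∣ f)
    {u : Fin 3 → Rk k} {t0 t1 : Rk k}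
    (h : ∀ i, (biform a b ⨯₃ u) i + t0 * adjSyz₀ a b i + t1 * adjSyz₁ a b i = 0) :
    ∃ v : Fin 3 → Rk k, (∀ i, u i = ∑ j, pencil a b j i * v j) ∧
      t0 = X 1 * v 1 - X 0 * v 2 ∧ t1 = X 0 * v 1 - X 1 * v 0 := by
  obtain ⟨e0, -, e2⟩ := dot_comb_cross (pencil a b) quadMon u
    ![X 1 * t0, X 1 * t1 - X 0 * t0, - X 0 * t1] fun i => by
      rw [← h i, ← biform_eq]
      simp [Fin.sum_univ_three, adjSyz₀, adjSyz₁]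
      ring
  have hu := colDet_mul' (pencil a b) u
  have hfix : substXY 0 0 (colDet (pencil a b)) = colDet (pencil a b) := substXY_colDet 0 0
  generalize colDet (pencil a b) = D at *
  obtain ⟨r, hr⟩ : ∃ r : Fin 3 → Rk k, ∀ j, adjRow (pencil a b) j ⬝ᵥ u = r j :=
    ⟨_, fun _ => rfl⟩
  simp only [hr] at hu e0 e2
  obtain ⟨v, h3, hv, ht0, ht1⟩ := exists_eq_add_quadMon_mul (t0 := t0) (t1 := t1) hD hfix
    (mul_left_cancel₀ (X_ne_zero (1 : Fin 4)) (by simp [quadMon] at e0; linear_combination e0))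
    (mul_left_cancel₀ (X_ne_zero (0 : Fin 4)) (by simp [quadMon] at e2; linear_combination -e2))
  have key : ∀ i, D * (u i - ∑ j, pencil a b j i * v j) = h3 * biform a b i := fun i => by
    rw [mul_sub, hu, biform_eq, Finset.mul_sum, Finset.mul_sum, ← Finset.sum_sub_distrib]
    exact Finset.sum_congr rfl fun j _ => by rw [hv]; ring
  obtain ⟨q, rfl⟩ : D ∣ h3 := hcop h3 fun i => ⟨_, (key i).symm⟩
  refine ⟨fun j => v j + quadMon j * q, fun i => ?_, ?_, ?_⟩
  · have := mul_left_cancel₀ hD ((key i).trans (mul_assoc _ _ _))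
    rw [sub_eq_iff_eq_add.1 this, biform_eq, Finset.mul_sum, ← Finset.sum_add_distrib]
    exact Finset.sum_congr rfl fun j _ => by ring
  · rw [ht0]
    simp [quadMon]
    ring
  · rw [ht1]
    simp [quadMon]
    ring

theorem exists_eq_syz₂_mulVec_of_eq_add (hD : colDet (pencil a b) ≠ 0)
    (hcop : ∀ f, (∀ i, colDet (pencil a b) ∣ f * biform a b i) → colDet (pencil a b) ∣ f)
    {v : Fin 6 → Rk k} (h : (syz₁ a b).mulVec v = 0) {f g : Rk k}
    (hfg : v 0 = X 2 * f + X 3 * g) :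
    ∃ u : Fin 5 → Rk k, v = (syz₂ a b).mulVec u := by
  obtain ⟨w, hw, h4, h5⟩ := exists_eq_of_cross_add_adjSyz hD hcop
    (u := fun i => ![v 1, v 2, v 3] i - quad a i * g + quad b i * f)
    (t0 := v 4) (t1 := v 5) fun i => by
      have hi := congrFun h i
      rw [syz₁_mulVec, Pi.zero_apply] at hi
      rw [← hi, hfg]
      fin_cases i <;> simp [cross_apply, biform] <;> ring
  refine ⟨![w 0, w 1, w 2, g, -f], ?_⟩
  have e0 := hw 0
  have e1 := hw 1
  have e2 := hw 2
  rw [syz₂_mulVec]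
  simp only [Fin.sum_univ_three] at e0 e1 e2 ⊢
  funext i
  fin_cases i <;> simp at e0 e1 e2 ⊢
  · linear_combination hfg
  · linear_combination e0
  · linear_combination e1
  · linear_combination e2
  · exact h4
  · exact h5

theorem exists_eq_syz₂_mulVec (hD : colDet (pencil a b) ≠ 0)
    (hg0 : X 0 ∈ (Ideal.span (Set.range (quad a ⨯₃ quad b))).radical)
    (hg1 : X 1 ∈ (Ideal.span (Set.range (quad a ⨯₃ quad b))).radical)
    {i₀ : Fin 3} (hg : (quad a ⨯₃ quad b) i₀ ≠ 0)
    {v : Fin 6 → Rk k} (h : (syz₁ a b).mulVec v = 0) :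
    ∃ u : Fin 5 → Rk k, v = (syz₂ a b).mulVec u := by
  have hi : ∀ i, v 0 * (quad a ⨯₃ quad b) i + (biform a b ⨯₃ ![v 1, v 2, v 3]) i +
      v 4 * adjSyz₀ a b i + v 5 * adjSyz₁ a b i = 0 := fun i => by
    rw [← syz₁_mulVec, h, Pi.zero_apply]
  have hgfix : substZW ((quad a ⨯₃ quad b) i₀) = (quad a ⨯₃ quad b) i₀ := by
    have := map_cross (substZW (k := k)).toRingHom (quad a) (quad b) i₀
    simpa [Function.comp_def, substZW_quad] using this
  have hv0 : substZW (v 0) = 0 := by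
    have := congrArg substZW (hi i₀)
    simp only [map_add, map_mul, map_zero, hgfix, substZW_biform_cross, substZW_adjSyz, mul_zero,
      add_zero] at this
    exact (mul_eq_zero.1 this).resolve_right hg
  obtain ⟨f, g, hfg⟩ := exists_of_substZW_eq_zero hv0
  exact exists_eq_syz₂_mulVec_of_eq_add hD (fun _ => dvd_of_dvd_mul_biform hg0 hg1) h hfg

end Rk

theorem dotProduct_comb_cross {S : Type*} [CommRing S] (N : Fin 3 → Fin 3 → S)
    (m u : Fin 3 → S) :
    N 0 ⬝ᵥ ((fun i => ∑ j, m j * N j i) ⨯₃ u) =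
        m 1 * (adjRow N 2 ⬝ᵥ u) - m 2 * (adjRow N 1 ⬝ᵥ u) ∧
      N 1 ⬝ᵥ ((fun i => ∑ j, m j * N j i) ⨯₃ u) =
        m 2 * (adjRow N 0 ⬝ᵥ u) - m 0 * (adjRow N 2 ⬝ᵥ u) ∧
      N 2 ⬝ᵥ ((fun i => ∑ j, m j * N j i) ⨯₃ u) =
        m 0 * (adjRow N 1 ⬝ᵥ u) - m 1 * (adjRow N 0 ⬝ᵥ u) := by
  refine ⟨?_, ?_, ?_⟩ <;>
    simp [adjRow, cross_apply, dotProduct, Fin.sum_univ_three] <;> ring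

namespace Rk

variable {k : Type*} [Field k] {a b : Fin 3 → Fin 3 → k}

theorem isWeightedHomogeneous_sub {f g : Rk k} {n : ℕ} (hf : f.IsWeightedHomogeneous wtXY n)
    (hg : g.IsWeightedHomogeneous wtXY n) : (f - g).IsWeightedHomogeneous wtXY n :=
  Submodule.sub_mem (weightedHomogeneousSubmodule k wtXY n) hf hg

theorem isWeightedHomogeneous_pencil (j i : Fin 3) :
    (pencil a b j i).IsWeightedHomogeneous wtXY 0 :=
  ((isWeightedHomogeneous_C wtXY (a j i)).mul (isWeightedHomogeneous_X k wtXY 2)).add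
    ((isWeightedHomogeneous_C wtXY (b j i)).mul (isWeightedHomogeneous_X k wtXY 3))

theorem isWeightedHomogeneous_quad (i : Fin 3) :
    (quad a i).IsWeightedHomogeneous wtXY 2 := by
  have h0 := isWeightedHomogeneous_X k wtXY 0
  have h1 := isWeightedHomogeneous_X k wtXY 1
  exact (((isWeightedHomogeneous_C wtXY _).mul (h0.pow 2)).add
    ((isWeightedHomogeneous_C wtXY _).mul (h0.mul h1))).add
      ((isWeightedHomogeneous_C wtXY _).mul (h1.pow 2))

theorem isWeightedHomogeneous_biform (i : Fin 3) :
    (biform a b i).IsWeightedHomogeneous wtXY 2 :=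
  ((isWeightedHomogeneous_X k wtXY 2).mul (isWeightedHomogeneous_quad i)).add
    ((isWeightedHomogeneous_X k wtXY 3).mul (isWeightedHomogeneous_quad i))

theorem isWeightedHomogeneous_cross {u v : Fin 3 → Rk k} {m n : ℕ}
    (hu : ∀ i, (u i).IsWeightedHomogeneous wtXY m)
    (hv : ∀ i, (v i).IsWeightedHomogeneous wtXY n) (i : Fin 3) :
    ((u ⨯₃ v) i).IsWeightedHomogeneous wtXY (m + n) := by
  fin_cases i <;>
    exact isWeightedHomogeneous_sub ((hu _).mul (hv _)) ((hu _).mul (hv _))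

theorem isWeightedHomogeneous_dotProduct {u v : Fin 3 → Rk k} {m n : ℕ}
    (hu : ∀ i, (u i).IsWeightedHomogeneous wtXY m)
    (hv : ∀ i, (v i).IsWeightedHomogeneous wtXY n) :
    (u ⬝ᵥ v).IsWeightedHomogeneous wtXY (m + n) :=
  IsWeightedHomogeneous.sum _ _ _ fun i _ => (hu i).mul (hv i)

theorem mem_range_syz₁ {f : Fin 3 → Rk k} (q : Rk k) (u : Fin 3 → Rk k) (t0 t1 : Rk k)
    (h : ∀ i, f i = q * (quad a ⨯₃ quad b) i + (biform a b ⨯₃ u) i + t0 * adjSyz₀ a b i +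
      t1 * adjSyz₁ a b i) : f ∈ LinearMap.range (syz₁ a b).mulVecLin := by
  refine ⟨![q, u 0, u 1, u 2, t0, t1], funext fun i => ?_⟩
  rw [mulVecLin_apply, syz₁_mulVec, h]
  have : ![u 0, u 1, u 2] = u := by
    funext j; fin_cases j <;> rfl
  simp [this]

theorem exists_colDet_mul_eq {f : Fin 3 → Rk k} (h : ∑ i, f i * biform a b i = 0) :
    ∃ t0 t1, (∀ i, colDet (pencil a b) * f i = t0 * adjSyz₀ a b i + t1 * adjSyz₁ a b i) ∧
      pencil a b 0 ⬝ᵥ f = X 1 * t0 ∧ pencil a b 1 ⬝ᵥ f = X 1 * t1 - X 0 * t0 ∧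
      pencil a b 2 ⬝ᵥ f = -X 0 * t1 := by
  have e : X 0 ^ 2 * (pencil a b 0 ⬝ᵥ f) + X 0 * X 1 * (pencil a b 1 ⬝ᵥ f) +
      X 1 ^ 2 * (pencil a b 2 ⬝ᵥ f) = 0 := by
    rw [← h, biform_eq]
    simp [quadMon, dotProduct, Fin.sum_univ_three]
    ring
  have hf := colDet_mul (pencil a b) f
  simp only [Fin.sum_univ_three] at hf
  generalize pencil a b 0 ⬝ᵥ f = b0 at *
  generalize pencil a b 1 ⬝ᵥ f = b1 at *
  generalize pencil a b 2 ⬝ᵥ f = b2 at *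
  obtain ⟨q, h1, h2⟩ := exists_of_X_mul_eq (i := (0 : Fin 4)) (j := 1) (by decide)
    (f := X 0 * b0 + X 1 * b1) (g := -(X 1 * b2)) (by linear_combination e)
  obtain ⟨t0, h3, h4⟩ := exists_of_X_mul_eq (i := (0 : Fin 4)) (j := 1) (by decide)
    (f := b0) (g := q - b1) (by linear_combination h1)
  obtain ⟨t1, h5, h6⟩ := exists_of_X_mul_eq (i := (0 : Fin 4)) (j := 1) (by decide)
    (f := q) (g := -b2) (by linear_combination -h2)
  refine ⟨t0, t1, fun i => ?_, h3, by linear_combination h5 - h4, by linear_combination -h6⟩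
  rw [hf i, adjSyz₀, adjSyz₁, h3, show b1 = X 1 * t1 - X 0 * t0 by linear_combination h5 - h4,
    show b2 = -X 0 * t1 by linear_combination -h6]
  ring

theorem exists_colDet_mul_eq_of_succ {f : Fin 3 → Rk k} (h : ∑ i, f i * biform a b i = 0)
    {n : ℕ} (hf : ∀ i, (f i).IsWeightedHomogeneous wtXY (n + 1)) :
    ∃ t0 t1 : Rk k, t0.IsWeightedHomogeneous wtXY n ∧ t1.IsWeightedHomogeneous wtXY n ∧
      ∀ i, colDet (pencil a b) * f i = t0 * adjSyz₀ a b i + t1 * adjSyz₁ a b i := by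
  obtain ⟨t0, t1, ht, h0, -, h2⟩ := exists_colDet_mul_eq h
  have hb : ∀ j, (pencil a b j ⬝ᵥ f).IsWeightedHomogeneous wtXY (n + 1) := fun j => by
    simpa using isWeightedHomogeneous_dotProduct (isWeightedHomogeneous_pencil j) hf
  refine ⟨t0, t1, ?_, ?_, ht⟩
  · refine isWeightedHomogeneous_of_mul (X_ne_zero 1) (isWeightedHomogeneous_X k wtXY 1) ?_
    rw [mul_comm, ← h0]
    exact hb 0
  · refine isWeightedHomogeneous_of_mul (X_ne_zero 0) (isWeightedHomogeneous_X k wtXY 0) ?_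
    rw [show t1 * X 0 = -(pencil a b 2 ⬝ᵥ f) by rw [h2]; ring]
    exact Submodule.neg_mem (weightedHomogeneousSubmodule k wtXY (n + 1)) (hb 2)

theorem eq_zero_of_isWeightedHomogeneous_zero (hD : colDet (pencil a b) ≠ 0)
    {f : Fin 3 → Rk k} (h : ∑ i, f i * biform a b i = 0)
    (hf : ∀ i, (f i).IsWeightedHomogeneous wtXY 0) : f = 0 := by
  obtain ⟨t0, t1, ht, -⟩ := exists_colDet_mul_eq h
  funext i
  have := congrArg (substXY 0 0) (ht i)
  rw [map_mul, substXY_colDet, substXY_eq_self (hf i)] at this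
  refine (mul_eq_zero.1 (this.trans ?_)).resolve_left hD
  simp [adjSyz₀, adjSyz₁, substXY]

theorem mem_range_syz₁_of_one (hD : colDet (pencil a b) ≠ 0)
    (hcop : ∀ F, (∀ i, colDet (pencil a b) ∣ F * adjConic (pencil a b) i) →
      colDet (pencil a b) ∣ F)
    {f : Fin 3 → Rk k} (h : ∑ i, f i * biform a b i = 0)
    (hf : ∀ i, (f i).IsWeightedHomogeneous wtXY 1) :
    f ∈ LinearMap.range (syz₁ a b).mulVecLin := by
  obtain ⟨t0, t1, h0, h1, ht⟩ := exists_colDet_mul_eq_of_succ h hf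
  have e : ∀ s t i, colDet (pencil a b) * substXY s t (f i) =
      t0 * (C t * adjRow (pencil a b) 0 i - C s * adjRow (pencil a b) 1 i) +
      t1 * (C t * adjRow (pencil a b) 1 i - C s * adjRow (pencil a b) 2 i) := fun s t i => by
    have := congrArg (substXY s t) (ht i)
    simp only [adjSyz₀, adjSyz₁, map_mul, map_add, map_sub, substXY_colDet, substXY_adjRow,
      substXY_eq_self h0, substXY_eq_self h1] at this
    rw [this]
    simp [substXY]
  obtain ⟨τ0, rfl⟩ := hcop t0 fun i =>
    ⟨-adjRow (pencil a b) 1 i * substXY 1 0 (f i) -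
      adjRow (pencil a b) 2 i * substXY 0 1 (f i), by
      have e1 := e 1 0 i
      have e2 := e 0 1 i
      simp only [map_one, map_zero] at e1 e2
      rw [adjConic]
      linear_combination adjRow (pencil a b) 1 i * e1 + adjRow (pencil a b) 2 i * e2⟩
  obtain ⟨τ1, rfl⟩ := hcop t1 fun i =>
    ⟨adjRow (pencil a b) 1 i * substXY 0 1 (f i) +
      adjRow (pencil a b) 0 i * substXY 1 0 (f i), by
      have e1 := e 1 0 i
      have e2 := e 0 1 i
      simp only [map_one, map_zero] at e1 e2
      rw [adjConic]
      linear_combination -adjRow (pencil a b) 1 i * e2 - adjRow (pencil a b) 0 i * e1⟩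
  refine mem_range_syz₁ 0 0 τ0 τ1 fun i => mul_left_cancel₀ hD ?_
  rw [ht i]
  simp
  ring

/-- If `q` is modulo `D` a multiple of each column of the adjugate, then it lies in the column
span of the adjugate. -/
theorem exists_eq_adjRow_dotProduct {N : Fin 3 → Fin 3 → Rk k} (hD : colDet N ≠ 0)
    (hcop : ∀ F, (∀ i, colDet N ∣ F * adjConic N i) → colDet N ∣ F) {q : Fin 3 → Rk k}
    (h : ∀ i l m, colDet N ∣ q m * adjRow N l i - q l * adjRow N m i) :
    ∃ u : Fin 3 → Rk k, ∀ j, q j = adjRow N j ⬝ᵥ u := by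
  have hdvd : ∀ i j l, colDet N ∣ (∑ m, N m j * q m) * adjRow N l i := fun i j l => by
    have e : (∑ m, N m j * q m) * adjRow N l i =
        ∑ m, N m j * (q m * adjRow N l i - q l * adjRow N m i) +
          q l * ∑ m, N m j * adjRow N m i := by
      simp only [Fin.sum_univ_three]
      ring
    rw [e]
    refine dvd_add (Finset.dvd_sum fun m _ => (h i l m).mul_left _) (Dvd.dvd.mul_left ?_ _)
    rw [sum_mul_adjRow]
    split_ifs
    · exact dvd_refl _
    · exact dvd_zero _
  have : ∀ j, colDet N ∣ ∑ m, N m j * q m := fun j => hcop _ fun i => by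
    rw [adjConic, mul_sub, pow_two, ← mul_assoc, ← mul_assoc]
    exact dvd_sub ((hdvd i j 1).mul_right _) ((hdvd i j 0).mul_right _)
  choose u hu using this
  exact ⟨u, fun j => mul_left_cancel₀ hD (colDet_mul_of_sum N q u _ hu j)⟩

theorem mem_range_syz₁_of_two (hD : colDet (pencil a b) ≠ 0)
    (hcop : ∀ F, (∀ i, colDet (pencil a b) ∣ F * adjConic (pencil a b) i) →
      colDet (pencil a b) ∣ F)
    {f : Fin 3 → Rk k} (h : ∑ i, f i * biform a b i = 0)
    (hf : ∀ i, (f i).IsWeightedHomogeneous wtXY 2) :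
    f ∈ LinearMap.range (syz₁ a b).mulVecLin := by
  obtain ⟨t0, t1, h0, h1, ht⟩ := exists_colDet_mul_eq_of_succ h hf
  obtain ⟨t00, t01, h00, h01, rfl⟩ := exists_of_isWeightedHomogeneous_succ h0
  obtain ⟨t10, t11, h10, h11, rfl⟩ := exists_of_isWeightedHomogeneous_succ h1
  have e : ∀ s t i, colDet (pencil a b) * substXY s t (f i) =
      (C s * t00 + C t * t01) *
        (C t * adjRow (pencil a b) 0 i - C s * adjRow (pencil a b) 1 i) +
      (C s * t10 + C t * t11) *
        (C t * adjRow (pencil a b) 1 i - C s * adjRow (pencil a b) 2 i) := fun s t i => by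
    have := congrArg (substXY s t) (ht i)
    simp only [adjSyz₀, adjSyz₁, map_mul, map_add, map_sub, substXY_colDet, substXY_adjRow,
      substXY_eq_self h00, substXY_eq_self h01, substXY_eq_self h10,
      substXY_eq_self h11] at this
    rw [this]
    simp [substXY]
  have e1 := e 0 1
  have e2 := e 1 1
  have e3 := e 1 0
  simp only [map_one, map_zero] at e1 e2 e3
  obtain ⟨τ, hτ⟩ := hcop (t10 - t01) fun i =>
    ⟨adjRow (pencil a b) 1 i * (substXY 1 1 (f i) - substXY 0 1 (f i) - substXY 1 0 (f i)) +
      adjRow (pencil a b) 0 i * substXY 1 0 (f i) +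
      adjRow (pencil a b) 2 i * substXY 0 1 (f i), by
      rw [adjConic]
      linear_combination -adjRow (pencil a b) 1 i * (e2 i - e1 i - e3 i) -
        adjRow (pencil a b) 0 i * e3 i - adjRow (pencil a b) 2 i * e1 i⟩
  obtain rfl : t01 = t10 - colDet (pencil a b) * τ := by linear_combination -hτ
  obtain ⟨u, hu⟩ := exists_eq_adjRow_dotProduct hD hcop (q := ![t11, -t10, t00]) fun i => by
    have d1 : colDet (pencil a b) ∣
        t11 * adjRow (pencil a b) 1 i + t10 * adjRow (pencil a b) 0 i :=
      ⟨substXY 0 1 (f i) + τ * adjRow (pencil a b) 0 i, by linear_combination -e1 i⟩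
    have d2 : colDet (pencil a b) ∣
        t00 * adjRow (pencil a b) 0 i - t11 * adjRow (pencil a b) 2 i :=
      ⟨substXY 1 1 (f i) - substXY 0 1 (f i) - substXY 1 0 (f i) -
        τ * adjRow (pencil a b) 1 i, by linear_combination -(e2 i - e1 i - e3 i)⟩
    have d3 : colDet (pencil a b) ∣
        t00 * adjRow (pencil a b) 1 i + t10 * adjRow (pencil a b) 2 i :=
      ⟨-substXY 1 0 (f i), by linear_combination e3 i⟩
    intro l m
    fin_cases l <;> fin_cases m <;> simp
    · simpa [sub_eq_add_neg, add_comm] using (dvd_neg.2 d1)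
    · exact d2
    · exact d1
    · exact d3
    · exact (dvd_neg.2 d2).trans (by simp)
    · exact (dvd_neg.2 d3).trans (by simp [sub_eq_add_neg, add_comm])
  have u0 := hu 0
  have u1 := hu 1
  have u2 := hu 2
  simp at u0 u1 u2
  refine mem_range_syz₁ 0 u (-X 1 * τ) 0 fun i => mul_left_cancel₀ hD ?_
  obtain ⟨c0, c1, c2⟩ := dotProduct_comb_cross (pencil a b) quadMon u
  have := colDet_mul (pencil a b) (biform a b ⨯₃ u) i
  rw [Fin.sum_univ_three, biform_eq, c0, c1, c2, ← u0, ← u1, ← u2, ← biform_eq] at this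
  rw [ht i, mul_add, mul_add, mul_add, this]
  simp [quadMon, adjSyz₀, adjSyz₁]
  ring

end Rk

namespace Rk

variable {k : Type*} [Field k] {a b : Fin 3 → Fin 3 → k}

section Parallel

/-- A vector parallel to a vector whose entries generate an ideal containing powers of `x, y`
is a multiple of it. -/
theorem exists_eq_mul_of_parallel {g q : Fin 3 → Rk k}
    (hg0 : X 0 ∈ (Ideal.span (Set.range g)).radical)
    (hg1 : X 1 ∈ (Ideal.span (Set.range g)).radical)
    (h : ∀ i j, q i * g j = q j * g i) : ∃ γ, ∀ i, q i = γ * g i := by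
  have key : ∀ v ∈ Ideal.span (Set.range g), ∃ c, ∀ i, q i * v = c * g i := fun v hv => by
    induction hv using Submodule.span_induction with
    | mem v hv =>
      obtain ⟨j, rfl⟩ := hv
      exact ⟨q j, fun i => h i j⟩
    | zero => exact ⟨0, fun i => by simp⟩
    | add u v _ _ hu hv =>
      obtain ⟨c, hc⟩ := hu
      obtain ⟨c', hc'⟩ := hv
      exact ⟨c + c', fun i => by rw [mul_add, hc, hc', add_mul]⟩
    | smul r u _ hu =>
      obtain ⟨c, hc⟩ := hu
      exact ⟨r * c, fun i => by rw [smul_eq_mul, mul_left_comm, hc, mul_assoc]⟩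
  obtain ⟨m, hm⟩ := hg0
  obtain ⟨n, hn⟩ := hg1
  obtain ⟨c, hc⟩ := key _ hm
  obtain ⟨c', hc'⟩ := key _ hn
  obtain ⟨i₀, hi₀⟩ : ∃ i, g i ≠ 0 := by
    by_contra! hz
    simp [show g = 0 from funext hz] at hm
  have e : X 1 ^ n * c = X 0 ^ m * c' := mul_right_cancel₀ hi₀ (by
    linear_combination -X 1 ^ n * hc i₀ + X 0 ^ m * hc' i₀)
  obtain ⟨γ, rfl⟩ : X 0 ^ m ∣ c :=
    (isRelPrime_X_pow (by decide) m n).dvd_of_dvd_mul_left ⟨c', e⟩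
  exact ⟨γ, fun i => mul_left_cancel₀ (pow_ne_zero m (X_ne_zero (0 : Fin 4))) (by
    linear_combination hc i)⟩

theorem cross_parallel_of_dotProduct_eq_zero {S : Type*} [CommRing S] {u v f : Fin 3 → S}
    (hu : f ⬝ᵥ u = 0) (hv : f ⬝ᵥ v = 0) (i j : Fin 3) :
    f i * (u ⨯₃ v) j = f j * (u ⨯₃ v) i := by
  simp only [dotProduct, Fin.sum_univ_three] at hu hv
  fin_cases i <;> fin_cases j <;> simp [cross_apply]
  · linear_combination -v 2 * hu + u 2 * hv
  · linear_combination v 1 * hu - u 1 * hv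
  · linear_combination v 2 * hu - u 2 * hv
  · linear_combination -v 0 * hu + u 0 * hv
  · linear_combination -v 1 * hu + u 1 * hv
  · linear_combination v 0 * hu - u 0 * hv

theorem mul_eq_mul_of_cross_eq_zero {S : Type*} [CommRing S] {u v : Fin 3 → S}
    (h : u ⨯₃ v = 0) (i j : Fin 3) : u i * v j = u j * v i := by
  have h0 := congrFun h 0
  have h1 := congrFun h 1
  have h2 := congrFun h 2
  simp only [cross_apply] at h0 h1 h2
  simp at h0 h1 h2
  fin_cases i <;> fin_cases j <;> simp only [Fin.zero_eta, Fin.mk_one, Fin.reduceFinMk] <;>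
    first
    | ring
    | linear_combination h0
    | linear_combination -h0
    | linear_combination h1
    | linear_combination -h1
    | linear_combination h2
    | linear_combination -h2

theorem mul_cross_eq_zero {S : Type*} [CommRing S] {l u v : Fin 3 → S} (hu : l ⨯₃ u = 0)
    (hv : l ⨯₃ v = 0) (i j : Fin 3) : l i * (u ⨯₃ v) j = 0 := by
  have hu := mul_eq_mul_of_cross_eq_zero hu
  have hv := mul_eq_mul_of_cross_eq_zero hv
  have key : ∀ m n, l i * (u m * v n - u n * v m) = 0 := fun m n => by
    linear_combination v n * hu i m - v m * hu i n + u i * hv m n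
  fin_cases j <;> exact key _ _

end Parallel

section Quintic

theorem mul_mem_of_isWeightedHomogeneous {I : Ideal (Rk k)} {n : ℕ} (m : ℕ) (u : Rk k)
    (hI : ∀ i ≤ m, u * (X 0 ^ i * X 1 ^ (m - i)) ∈ I) {f : Rk k}
    (hf : f.IsWeightedHomogeneous wtXY (n + m)) : u * f ∈ I := by
  induction m generalizing u f with
  | zero =>
    have := hI 0 le_rfl
    simp only [zero_tsub, pow_zero, mul_one] at this
    exact I.mul_mem_right _ this
  | succ m ih =>
    obtain ⟨f0, f1, h0, h1, rfl⟩ := exists_of_isWeightedHomogeneous_succ hf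
    rw [mul_add, ← mul_assoc, ← mul_assoc]
    refine I.add_mem (ih _ (fun i hi => ?_) h0) (ih _ (fun i hi => ?_) h1)
    · have := hI (i + 1) (by omega)
      rw [show m + 1 - (i + 1) = m - i by omega] at this
      convert this using 1
      ring
    · have := hI i (by omega)
      rw [show m + 1 - i = m - i + 1 by omega] at this
      convert this using 1
      ring

/-- The linear map sending a triple of linear forms in `x, y` to its dot product with `A × B`. -/
def quinticMap (a b : Fin 3 → Fin 3 → k) : (Fin 3 → Fin 2 → k) →ₗ[k] Rk k where
  toFun l := (fun i => C (l i 0) * X 0 + C (l i 1) * X 1) ⬝ᵥ (quad a ⨯₃ quad b)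
  map_add' l m := by
    rw [← add_dotProduct]
    congr 1
    funext i
    simp only [Pi.add_apply, C_add]
    ring
  map_smul' c l := by
    rw [RingHom.id_apply, smul_eq_C_mul, ← smul_eq_mul, ← smul_dotProduct]
    congr 1
    funext i
    simp only [Pi.smul_apply, smul_eq_mul, C_mul]
    ring

theorem quinticMap_apply (l : Fin 3 → Fin 2 → k) : quinticMap a b l =
    ∑ i, (C (l i 0) * X 0 + C (l i 1) * X 1) * (quad a ⨯₃ quad b) i := rfl

theorem ker_quinticMap (hg0 : X 0 ∈ (Ideal.span (Set.range (quad a ⨯₃ quad b))).radical)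
    (hg1 : X 1 ∈ (Ideal.span (Set.range (quad a ⨯₃ quad b))).radical) {i₀ : Fin 3}
    (hg : (quad a ⨯₃ quad b) i₀ ≠ 0) : LinearMap.ker (quinticMap a b) = ⊥ := by
  rw [LinearMap.ker_eq_bot']
  intro l hl
  obtain ⟨L, hL⟩ : ∃ L : Fin 3 → Rk k, L = fun i => C (l i 0) * X 0 + C (l i 1) * X 1 :=
    ⟨_, rfl⟩
  have hLg : L ⬝ᵥ (quad a ⨯₃ quad b) = 0 := hL ▸ hl
  have hL1 : ∀ i, (L i).IsWeightedHomogeneous wtXY 1 := fun i => by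
    rw [hL]
    exact ((isWeightedHomogeneous_C wtXY _).mul (isWeightedHomogeneous_X k wtXY 0)).add
      ((isWeightedHomogeneous_C wtXY _).mul (isWeightedHomogeneous_X k wtXY 1))
  have hg4 := isWeightedHomogeneous_cross (isWeightedHomogeneous_quad (a := a))
    (isWeightedHomogeneous_quad (a := b))
  have key : ∀ c, (L ⨯₃ quad c) ⬝ᵥ quad a = 0 → (L ⨯₃ quad c) ⬝ᵥ quad b = 0 →
      L ⨯₃ quad c = 0 := fun c ha hb => by
    obtain ⟨γ, hγ⟩ := exists_eq_mul_of_parallel hg0 hg1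
      (cross_parallel_of_dotProduct_eq_zero ha hb)
    funext i
    rw [hγ i]
    refine eq_zero_of_isWeightedHomogeneous_mul (n := 3) (by norm_num) (hg4 i) ?_
    rw [← hγ i]
    exact isWeightedHomogeneous_cross hL1 isWeightedHomogeneous_quad i
  have ha : L ⨯₃ quad a = 0 := by
    refine key a ?_ ?_
    · simp [cross_apply, dotProduct, Fin.sum_univ_three]; ring
    · rw [← hLg]
      simp [cross_apply, dotProduct, Fin.sum_univ_three]; ring
  have hb : L ⨯₃ quad b = 0 := by
    refine key b ?_ ?_
    · rw [← neg_eq_zero, ← hLg]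
      simp [cross_apply, dotProduct, Fin.sum_univ_three]; ring
    · simp [cross_apply, dotProduct, Fin.sum_univ_three]; ring
  have hLz : ∀ i, L i = 0 := fun i =>
    (mul_eq_zero.1 (mul_cross_eq_zero ha hb i i₀)).resolve_right hg
  funext i j
  have hi := hLz i
  rw [hL] at hi
  fin_cases j
  · simpa using congrArg (eval ![1, 0, 0, 0]) hi
  · simpa using congrArg (eval ![0, 1, 0, 0]) hi

theorem range_quinticMap_le : LinearMap.range (quinticMap a b) ≤
    Submodule.span k (Set.range fun i : Fin 6 => (X 0 ^ (i : ℕ) * X 1 ^ (5 - (i : ℕ)) : Rk k)) := by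
  set W := Submodule.span k
    (Set.range fun i : Fin 6 => (X 0 ^ (i : ℕ) * X 1 ^ (5 - (i : ℕ)) : Rk k)) with hW
  have key : ∀ (l : Fin 2 → k) (c d : Fin 3 → Fin 3 → k) (i j : Fin 3),
      (C (l 0) * X 0 + C (l 1) * X 1) * (quad c i * quad d j) ∈ W := fun l c d i j => by
    rw [hW, Submodule.mem_span_range_iff_exists_fun]
    refine ⟨![l 1 * c 2 i * d 2 j,
      l 0 * c 2 i * d 2 j + l 1 * (c 1 i * d 2 j + c 2 i * d 1 j),
      l 0 * (c 1 i * d 2 j + c 2 i * d 1 j) +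
        l 1 * (c 0 i * d 2 j + c 1 i * d 1 j + c 2 i * d 0 j),
      l 0 * (c 0 i * d 2 j + c 1 i * d 1 j + c 2 i * d 0 j) +
        l 1 * (c 0 i * d 1 j + c 1 i * d 0 j),
      l 0 * (c 0 i * d 1 j + c 1 i * d 0 j) + l 1 * c 0 i * d 0 j,
      l 0 * c 0 i * d 0 j], ?_⟩
    simp [Fin.sum_univ_six, smul_eq_C_mul, quad]
    ring
  rintro _ ⟨l, rfl⟩
  rw [quinticMap_apply]
  refine Submodule.sum_mem _ fun i _ => ?_
  fin_cases i <;> simp only [cross_apply] <;> simp [mul_sub] <;>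
    exact Submodule.sub_mem _ (key (l _) _ _ _ _) (key (l _) _ _ _ _)

theorem mem_span_cross_of_isWeightedHomogeneous
    (hg0 : X 0 ∈ (Ideal.span (Set.range (quad a ⨯₃ quad b))).radical)
    (hg1 : X 1 ∈ (Ideal.span (Set.range (quad a ⨯₃ quad b))).radical) {i₀ : Fin 3}
    (hg : (quad a ⨯₃ quad b) i₀ ≠ 0) {n : ℕ} {f : Rk k}
    (hf : f.IsWeightedHomogeneous wtXY (n + 5)) :
    f ∈ Ideal.span (Set.range (quad a ⨯₃ quad b)) := by
  have hrange : LinearMap.range (quinticMap a b) = Submodule.span k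
      (Set.range fun i : Fin 6 => (X 0 ^ (i : ℕ) * X 1 ^ (5 - (i : ℕ)) : Rk k)) := by
    have : FiniteDimensional k (Submodule.span k
      (Set.range fun i : Fin 6 => (X 0 ^ (i : ℕ) * X 1 ^ (5 - (i : ℕ)) : Rk k))) :=
      FiniteDimensional.span_of_finite k (Set.finite_range _)
    refine Submodule.eq_of_le_of_finrank_le range_quinticMap_le ?_
    rw [LinearMap.finrank_range_of_inj (LinearMap.ker_eq_bot.1 (ker_quinticMap hg0 hg1 hg))]
    refine (finrank_range_le_card _).trans ?_
    simp [Module.finrank_pi_fintype]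
  rw [← one_mul f]
  refine mul_mem_of_isWeightedHomogeneous 5 1 (fun i hi => ?_) hf
  obtain ⟨l, hl⟩ : X 0 ^ i * X 1 ^ (5 - i) ∈ LinearMap.range (quinticMap a b) :=
    hrange ▸ Submodule.subset_span ⟨⟨i, by omega⟩, rfl⟩
  rw [one_mul, ← hl]
  rw [quinticMap_apply]
  refine Submodule.sum_mem _ fun j _ => ?_
  exact Ideal.mul_mem_left _ _ (Ideal.subset_span (Set.mem_range_self j))

end Quintic

theorem mem_range_syz₁_of_three
    (hg0 : X 0 ∈ (Ideal.span (Set.range (quad a ⨯₃ quad b))).radical)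
    (hg1 : X 1 ∈ (Ideal.span (Set.range (quad a ⨯₃ quad b))).radical) {i₀ : Fin 3}
    (hg : (quad a ⨯₃ quad b) i₀ ≠ 0) {n : ℕ} {f : Fin 3 → Rk k}
    (h : ∑ i, f i * biform a b i = 0) (hf : ∀ i, (f i).IsWeightedHomogeneous wtXY (n + 3)) :
    f ∈ LinearMap.range (syz₁ a b).mulVecLin := by
  obtain ⟨e, h1, h2⟩ := exists_of_X_mul_eq (i := (2 : Fin 4)) (j := 3) (by decide)
    (f := f ⬝ᵥ quad a) (g := -(f ⬝ᵥ quad b)) (by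
      rw [mul_neg, eq_neg_iff_add_eq_zero, ← h]
      simp only [dotProduct, biform, Fin.sum_univ_three]
      ring)
  have he : e.IsWeightedHomogeneous wtXY (n + 5) := by
    refine isWeightedHomogeneous_of_mul (X_ne_zero 3) (isWeightedHomogeneous_X k wtXY 3) ?_
    rw [mul_comm, ← h1]
    have hfa := isWeightedHomogeneous_dotProduct hf (isWeightedHomogeneous_quad (a := a))
    exact hfa
  obtain ⟨v, rfl⟩ := Ideal.mem_span_range_iff_exists_fun.1
    (mem_span_cross_of_isWeightedHomogeneous hg0 hg1 hg he)
  obtain ⟨γ, hγ⟩ := exists_eq_mul_of_parallel hg0 hg1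
    (cross_parallel_of_dotProduct_eq_zero (f := f - biform a b ⨯₃ v) (u := quad a)
      (v := quad b) (by
        rw [sub_dotProduct, h1]
        simp [Fin.sum_univ_three, dotProduct, cross_apply, biform]
        ring) (by
        rw [sub_dotProduct, neg_eq_iff_eq_neg.1 h2]
        simp [Fin.sum_univ_three, dotProduct, cross_apply, biform]
        ring))
  exact mem_range_syz₁ γ v 0 0 fun i => by
    rw [← hγ i]
    simp

section Grading

attribute [local instance] MvPolynomial.weightedGradedAlgebra

theorem mem_of_forall_isWeightedHomogeneous {P : Submodule (Rk k) (Fin 3 → Rk k)}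
    {p : Fin 3 → Rk k} {m : ℕ} (hp : ∀ i, (p i).IsWeightedHomogeneous wtXY m)
    (hP : ∀ n f, (∀ i, (f i).IsWeightedHomogeneous wtXY n) → ∑ i, f i * p i = 0 → f ∈ P)
    {f : Fin 3 → Rk k} (h : ∑ i, f i * p i = 0) : f ∈ P := by
  classical
  set A := weightedHomogeneousSubmodule k wtXY
  set s := Finset.univ.biUnion fun i => (DirectSum.decompose A (f i)).support with hs
  have hf : f = ∑ n ∈ s, fun i => (DirectSum.decompose A (f i) n : Rk k) := by
    funext i
    rw [Finset.sum_apply]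
    conv_lhs => rw [← DirectSum.sum_support_decompose A (f i)]
    refine Finset.sum_subset (Finset.subset_biUnion_of_mem
      (fun i => (DirectSum.decompose A (f i)).support) (Finset.mem_univ i)) fun n _ hn => ?_
    rw [DFinsupp.notMem_support_iff.1 hn]
    rfl
  rw [hf]
  refine P.sum_mem fun n _ => hP n _ (fun i => (DirectSum.decompose A (f i) n).2) ?_
  have := congrArg (fun r => (DirectSum.decompose A r (n + m) : Rk k)) h
  simpa only [DirectSum.decompose_sum, DirectSum.sum_apply, AddSubmonoidClass.coe_finsetSum,
    fun i => DirectSum.coe_decompose_mul_add_of_right_mem A (a := f i) (i := n) (hp i),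
    DirectSum.decompose_zero, DirectSum.zero_apply, ZeroMemClass.coe_zero] using this

end Grading

theorem exists_eq_syz₁_mulVec (hD : colDet (pencil a b) ≠ 0)
    (hcop : ∀ F, (∀ i, colDet (pencil a b) ∣ F * adjConic (pencil a b) i) →
      colDet (pencil a b) ∣ F)
    (hg0 : X 0 ∈ (Ideal.span (Set.range (quad a ⨯₃ quad b))).radical)
    (hg1 : X 1 ∈ (Ideal.span (Set.range (quad a ⨯₃ quad b))).radical) {i₀ : Fin 3}
    (hg : (quad a ⨯₃ quad b) i₀ ≠ 0) {f : Fin 3 → Rk k}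
    (h : ∑ i, f i * biform a b i = 0) : ∃ u : Fin 6 → Rk k, f = (syz₁ a b).mulVec u := by
  obtain ⟨u, hu⟩ : f ∈ LinearMap.range (syz₁ a b).mulVecLin := by
    refine mem_of_forall_isWeightedHomogeneous isWeightedHomogeneous_biform (fun n f hf h => ?_) h
    match n with
    | 0 =>
      rw [eq_zero_of_isWeightedHomogeneous_zero hD h hf]
      exact Submodule.zero_mem _
    | 1 => exact mem_range_syz₁_of_one hD hcop h hf
    | 2 => exact mem_range_syz₁_of_two hD hcop h hf
    | n + 3 => exact mem_range_syz₁_of_three hg0 hg1 hg h hf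
  exact ⟨u, hu.symm⟩

end Rk

namespace Rk

variable {k : Type*} [Field k] {a b : Fin 3 → Fin 3 → k}

section Scalars

theorem exists_comb_eq_zero_of_cross_eq_zero {u v : Fin 3 → k} (h : u ⨯₃ v = 0) :
    ∃ c d : k, (c, d) ≠ (0, 0) ∧ ∀ i, c * u i + d * v i = 0 := by
  by_cases hu : ∃ i, u i ≠ 0
  · obtain ⟨i, hi⟩ := hu
    exact ⟨-v i, u i, by simp [hi], fun j => by
      linear_combination mul_eq_mul_of_cross_eq_zero h i j⟩
  · push Not at hu
    exact ⟨1, 0, by simp, by simp [hu]⟩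

theorem exists_quartic_eq_zero [IsAlgClosed k] (c0 c1 c2 c3 c4 : k) :
    ∃ s t : k, (s, t) ≠ (0, 0) ∧
      c0 * s ^ 4 + c1 * s ^ 3 * t + c2 * s ^ 2 * t ^ 2 + c3 * s * t ^ 3 + c4 * t ^ 4 = 0 := by
  by_cases h : c0 = 0
  · exact ⟨1, 0, by simp, by simp [h]⟩
  · have hdeg : (Polynomial.C c0 * Polynomial.X ^ 4 + Polynomial.C c1 * Polynomial.X ^ 3 +
        Polynomial.C c2 * Polynomial.X ^ 2 + Polynomial.C c3 * Polynomial.X +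
        Polynomial.C c4).degree = 4 := by
      compute_degree!
    obtain ⟨s, hs⟩ := IsAlgClosed.exists_root _ (by rw [hdeg]; norm_num)
    refine ⟨s, 1, by simp, ?_⟩
    simpa [Polynomial.IsRoot] using hs

theorem exists_proportional_sq {κ : Fin 3 → k} (h : κ 1 ^ 2 - κ 0 * κ 2 = 0) (hκ : κ ≠ 0) :
    ∃ s t e : k, (s, t) ≠ (0, 0) ∧
      s ^ 2 = e * κ 0 ∧ s * t = e * κ 1 ∧ t ^ 2 = e * κ 2 := by
  by_cases h0 : κ 0 = 0
  · have h1 : κ 1 = 0 := by simpa [h0] using h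
    have h2 : κ 2 ≠ 0 := fun h2 => hκ (by funext i; fin_cases i <;> simp [h0, h1, h2])
    exact ⟨0, 1, (κ 2)⁻¹, by simp, by simp [h0], by simp [h1], by simp [h2]⟩
  · exact ⟨κ 0, κ 1, κ 0, by simp [h0], by ring, by ring, by linear_combination h⟩

/-- A nonzero vector has infinitely many points in the line of `ℙ²` orthogonal to it. -/
theorem infinite_dotProduct_eq_zero [Infinite k] {v : Fin 3 → k} (hv : v ≠ 0) :
    {P : Projectivization k (Fin 3 → k) | P.rep ⬝ᵥ v = 0}.Infinite := by
  have key : ∀ (r : k → Fin 3 → k) (i j : Fin 3) (e : k), e ≠ 0 → (∀ s, r s i = e) →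
      (∀ s, r s j = s * e) → (∀ s, r s ⬝ᵥ v = 0) →
      {P : Projectivization k (Fin 3 → k) | P.rep ⬝ᵥ v = 0}.Infinite := by
    intro r i j e he hi hj hr
    have hne : ∀ s, r s ≠ 0 := fun s h => he (by rw [← hi s, h, Pi.zero_apply])
    refine Set.infinite_of_injective_forall_mem
      (f := fun s => Projectivization.mk k (r s) (hne s)) (fun s t hst => ?_) fun s => ?_
    · obtain ⟨u, hu⟩ := (Projectivization.mk_eq_mk_iff' ..).1 hst
      have hui := congrFun hu i
      have huj := congrFun hu j
      rw [Pi.smul_apply, smul_eq_mul, hi, hi] at hui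
      rw [Pi.smul_apply, smul_eq_mul, hj, hj] at huj
      exact mul_right_cancel₀ he (by linear_combination t * hui - huj)
    · obtain ⟨u, hu⟩ := Projectivization.exists_smul_eq_mk_rep k (r s) (hne s)
      rw [Set.mem_ofPred_eq, ← hu, smul_dotProduct, hr, smul_zero]
  obtain ⟨i, hi⟩ := Function.ne_iff.1 hv
  fin_cases i
  · exact key (fun s => ![-v 1 - s * v 2, v 0, s * v 0]) 1 2 (v 0) hi (by simp) (by simp)
      fun s => by simp [dotProduct, Fin.sum_univ_three]; ring
  · exact key (fun s => ![v 1, -v 0 - s * v 2, s * v 1]) 0 2 (v 1) hi (by simp) (by simp)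
      fun s => by simp [dotProduct, Fin.sum_univ_three]; ring
  · exact key (fun s => ![v 2, s * v 2, -v 0 - s * v 1]) 0 1 (v 2) hi (by simp) (by simp)
      fun s => by simp [dotProduct, Fin.sum_univ_three]; ring

theorem exists_forall_dotProduct_eq_zero {N : Fin 3 → Fin 3 → k} (h : ∀ j i, adjRow N j i = 0) :
    ∃ v : Fin 3 → k, v ≠ 0 ∧ ∀ r, r ⬝ᵥ v = 0 → ∀ j, r ⬝ᵥ N j = 0 := by
  by_cases hN : N = 0
  · refine ⟨fun _ => 1, fun h => ?_, fun r _ j => by simp [hN]⟩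
    simpa using congrFun h 0
  obtain ⟨l, hl⟩ := Function.ne_iff.1 hN
  refine ⟨N l, hl, fun r hr j => ?_⟩
  obtain ⟨i, hi⟩ := Function.ne_iff.1 hl
  have h0 : N 1 ⨯₃ N 2 = 0 := funext (h 0)
  have h1 : N 2 ⨯₃ N 0 = 0 := funext (h 1)
  have h2 : N 0 ⨯₃ N 1 = 0 := funext (h 2)
  have hpar : ∀ m, N l i * N j m = N l m * N j i := by
    have key : ∀ {u v : Fin 3 → k}, u ⨯₃ v = 0 → ∀ m n, v m * u n = v n * u m :=
      fun h m n => by linear_combination -mul_eq_mul_of_cross_eq_zero h m n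
    intro m
    fin_cases l <;> fin_cases j <;>
      first
      | exact mul_comm _ _
      | exact mul_eq_mul_of_cross_eq_zero h0 _ _
      | exact mul_eq_mul_of_cross_eq_zero h1 _ _
      | exact mul_eq_mul_of_cross_eq_zero h2 _ _
      | exact key h0 _ _
      | exact key h1 _ _
      | exact key h2 _ _
  refine (mul_eq_zero.1 ?_).resolve_left hi
  calc N l i * (r ⬝ᵥ N j) = N j i * (r ⬝ᵥ N l) := by
        simp only [dotProduct, Finset.mul_sum]
        exact Finset.sum_congr rfl fun m _ => by linear_combination r m * hpar m
    _ = 0 := by rw [hr, mul_zero]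

end Scalars

/-- The forms `biform a b` have no common zero on `ℙ¹ × ℙ¹`. -/
def NoZero (a b : Fin 3 → Fin 3 → k) : Prop :=
  ∀ x : Fin 4 → k, (x 0, x 1) ≠ (0, 0) → (x 2, x 3) ≠ (0, 0) → ∃ i, eval x (biform a b i) ≠ 0

/-- Only finitely many points of `ℙ²` lie in the kernel of a member of the pencil. -/
def FinitelyDegenerate (a b : Fin 3 → Fin 3 → k) : Prop :=
  {P : Projectivization k (Fin 3 → k) | ∃ c d : k, (c, d) ≠ (0, 0) ∧
    ∀ j, c * (P.rep ⬝ᵥ a j) + d * (P.rep ⬝ᵥ b j) = 0}.Finite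

theorem X_mem_radical_span [IsAlgClosed k] {s : Set (Rk k)} {i : Fin 4}
    (h : ∀ x : Fin 4 → k, x i ≠ 0 → ∃ u ∈ s, eval x u ≠ 0) :
    X i ∈ (Ideal.span s).radical := by
  rw [← vanishingIdeal_zeroLocus_eq_radical (K := k), mem_vanishingIdeal_iff]
  intro x hx
  rw [zeroLocus_span] at hx
  by_contra hi
  obtain ⟨u, hu, hxu⟩ := h x (by simpa using hi)
  exact hxu (by simpa using hx u hu)

theorem NoZero.exists_eval_cross_ne_zero (h : NoZero a b) {x : Fin 4 → k}
    (hx : (x 0, x 1) ≠ (0, 0)) : ∃ i, eval x ((quad a ⨯₃ quad b) i) ≠ 0 := by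
  by_contra! hz
  obtain ⟨c, d, hcd, e⟩ := exists_comb_eq_zero_of_cross_eq_zero
    (u := eval x ∘ quad a) (v := eval x ∘ quad b) (funext fun i => by
      rw [← map_cross (eval x), hz, Pi.zero_apply])
  obtain ⟨i, hi⟩ := h ![x 0, x 1, c, d] hx hcd
  exact hi (by rw [← e i]; simp [biform, quad])

theorem NoZero.exists_cross_ne_zero (h : NoZero a b) : ∃ i, (quad a ⨯₃ quad b) i ≠ 0 := by
  obtain ⟨i, hi⟩ := h.exists_eval_cross_ne_zero (x := fun _ => 1) (by simp)
  exact ⟨i, fun e => hi (by rw [e, map_zero])⟩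

theorem NoZero.exists_biform_ne_zero (h : NoZero a b) : ∃ i, biform a b i ≠ 0 := by
  obtain ⟨i, hi⟩ := h (fun _ => 1) (by simp) (by simp)
  exact ⟨i, fun e => hi (by rw [e, map_zero])⟩

theorem NoZero.X_mem_radical [IsAlgClosed k] (h : NoZero a b) :
    X 0 ∈ (Ideal.span (Set.range (quad a ⨯₃ quad b))).radical ∧
      X 1 ∈ (Ideal.span (Set.range (quad a ⨯₃ quad b))).radical := by
  constructor <;> refine X_mem_radical_span fun x hx => ?_ <;>
    obtain ⟨i, hi⟩ := h.exists_eval_cross_ne_zero (x := x) (by simp [hx]) <;>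
    exact ⟨_, ⟨i, rfl⟩, hi⟩

theorem eval_colDet (x : Fin 4 → k) :
    eval x (colDet (pencil a b)) = colDet fun j i => a j i * x 2 + b j i * x 3 := by
  rw [map_colDet]
  simp [pencil]

theorem eval_adjConic (x : Fin 4 → k) (i : Fin 3) :
    eval x (adjConic (pencil a b) i) = adjConic (fun j i => a j i * x 2 + b j i * x 3) i := by
  rw [map_adjConic]
  simp [pencil]

theorem exists_dotProduct_eq_zero_of_colDet_eq_zero {N : Fin 3 → Fin 3 → k} (h : colDet N = 0) :
    ∃ r : Fin 3 → k, r ≠ 0 ∧ ∀ j, r ⬝ᵥ N j = 0 := by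
  obtain ⟨r, hr, e⟩ := (Matrix.exists_mulVec_eq_zero_iff (M := Matrix.of N)).2 (by
    rw [← h, Matrix.det_fin_three]
    simp [colDet, cross_apply, dotProduct, Fin.sum_univ_three]
    ring)
  exact ⟨r, hr, fun j => by rw [dotProduct_comm]; exact congrFun e j⟩

theorem exists_quad_cross_eq_zero [IsAlgClosed k] (i : Fin 3) : ∃ x : Fin 4 → k,
    (x 0, x 1) ≠ (0, 0) ∧ eval x ((quad a ⨯₃ quad b) i) = 0 := by
  have key : ∀ m n, ∃ x : Fin 4 → k, (x 0, x 1) ≠ (0, 0) ∧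
      eval x (quad a m * quad b n - quad a n * quad b m) = 0 := fun m n => by
    obtain ⟨s, t, hst, e⟩ := exists_quartic_eq_zero
      (a 0 m * b 0 n - a 0 n * b 0 m)
      (a 0 m * b 1 n + a 1 m * b 0 n - a 0 n * b 1 m - a 1 n * b 0 m)
      (a 0 m * b 2 n + a 1 m * b 1 n + a 2 m * b 0 n - a 0 n * b 2 m - a 1 n * b 1 m -
        a 2 n * b 0 m)
      (a 1 m * b 2 n + a 2 m * b 1 n - a 1 n * b 2 m - a 2 n * b 1 m)
      (a 2 m * b 2 n - a 2 n * b 2 m)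
    refine ⟨![s, t, 0, 0], hst, ?_⟩
    rw [← e]
    simp [quad]
    ring
  fin_cases i <;> exact key _ _

theorem colDet_pencil_ne_zero [IsAlgClosed k] (h : NoZero a b) (hfin : FinitelyDegenerate a b) :
    colDet (pencil a b) ≠ 0 := by
  intro hD
  have hex : ∀ c : k, ∃ r : Fin 3 → k, r ≠ 0 ∧ ∀ j, c * (r ⬝ᵥ a j) + r ⬝ᵥ b j = 0 := fun c => by
    have := eval_colDet (a := a) (b := b) ![0, 0, c, 1]
    rw [hD, map_zero] at this
    obtain ⟨r, hr, e⟩ := exists_dotProduct_eq_zero_of_colDet_eq_zero this.symm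
    refine ⟨r, hr, fun j => ?_⟩
    rw [← e j]
    simp [dotProduct, Fin.sum_univ_three]
    ring
  choose r hr e using hex
  obtain ⟨c, c', hcc, hrr⟩ : ∃ c c', c ≠ c' ∧
      Projectivization.mk k (r c) (hr c) = Projectivization.mk k (r c') (hr c') := by
    by_contra! hinj
    refine (Set.infinite_of_injective_forall_mem
      (f := fun c => Projectivization.mk k (r c) (hr c))
      (fun c c' hc => by_contra fun hne => hinj c c' hne hc) fun c => ?_) hfin
    obtain ⟨u, hu⟩ := Projectivization.exists_smul_eq_mk_rep k (r c) (hr c)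
    refine ⟨c, 1, by simp, fun j => ?_⟩
    rw [← hu, Units.smul_def, smul_dotProduct, smul_dotProduct, smul_eq_mul, smul_eq_mul]
    linear_combination (u : k) * e c j
  obtain ⟨u, hu⟩ := (Projectivization.mk_eq_mk_iff' ..).1 hrr
  have hu0 : ∀ j, c' * (r c ⬝ᵥ a j) + r c ⬝ᵥ b j = 0 := fun j => by
    rw [← hu, smul_dotProduct, smul_dotProduct, smul_eq_mul, smul_eq_mul]
    linear_combination u * e c' j
  have ha : ∀ j, r c ⬝ᵥ a j = 0 := fun j =>
    (mul_eq_zero.1 (by linear_combination e c j - hu0 j :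
      (c - c') * (r c ⬝ᵥ a j) = 0)).resolve_left (sub_ne_zero.2 hcc)
  have hb : ∀ j, r c ⬝ᵥ b j = 0 := fun j => by simpa [ha j] using e c j
  obtain ⟨i, hi⟩ := Function.ne_iff.1 (hr c)
  obtain ⟨x, hx, hxi⟩ := exists_quad_cross_eq_zero (a := a) (b := b) i
  obtain ⟨j, hj⟩ := h.exists_eval_cross_ne_zero hx
  have hquad : ∀ f : Fin 3 → Fin 3 → k, (∀ j, r c ⬝ᵥ f j = 0) →
      r c ⬝ᵥ (eval x ∘ quad f) = 0 := fun f hf => by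
    have h0 := hf 0
    have h1 := hf 1
    have h2 := hf 2
    simp only [dotProduct, Fin.sum_univ_three] at h0 h1 h2
    simp [quad, dotProduct, Fin.sum_univ_three]
    linear_combination x 0 ^ 2 * h0 + x 0 * x 1 * h1 + x 1 ^ 2 * h2
  have := cross_parallel_of_dotProduct_eq_zero (hquad a ha) (hquad b hb) i j
  rw [← map_cross (eval x), ← map_cross (eval x), hxi, mul_zero] at this
  exact (mul_ne_zero hi hj) this

theorem exists_adjRow_ne_zero [IsAlgClosed k] (hfin : FinitelyDegenerate a b) {c d : k}
    (hcd : (c, d) ≠ (0, 0)) :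
    ∃ i j, adjRow (fun j i => a j i * c + b j i * d) j i ≠ 0 := by
  by_contra! hz
  obtain ⟨v, hv, e⟩ := exists_forall_dotProduct_eq_zero fun j i => hz i j
  refine infinite_dotProduct_eq_zero hv (hfin.subset fun P hP => ⟨c, d, hcd, fun j => ?_⟩)
  rw [← e _ hP j]
  simp [dotProduct, Fin.sum_univ_three]
  ring

theorem exists_adjConic_ne_zero [IsAlgClosed k] (h : NoZero a b) (hfin : FinitelyDegenerate a b)
    {x : Fin 4 → k} (hx : (x 2, x 3) ≠ (0, 0)) (hD : eval x (colDet (pencil a b)) = 0) :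
    ∃ i, eval x (adjConic (pencil a b) i) ≠ 0 := by
  by_contra! hz
  obtain ⟨i, j, hij⟩ := exists_adjRow_ne_zero hfin hx
  have hi := hz i
  rw [eval_adjConic] at hi
  rw [eval_colDet] at hD
  obtain ⟨s, t, e, hst, e0, e1, e2⟩ := exists_proportional_sq
    (κ := fun j => adjRow (fun j i => a j i * x 2 + b j i * x 3) j i) hi
    fun h => hij (congrFun h j)
  obtain ⟨m, hm⟩ := h ![s, t, x 2, x 3] hst hx
  refine hm ?_
  have := sum_mul_adjRow (fun j i => a j i * x 2 + b j i * x 3) m i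
  rw [hD, ite_self, Fin.sum_univ_three] at this
  simp [biform, quad]
  linear_combination e * this + (a 0 m * x 2 + b 0 m * x 3) * e0 +
    (a 1 m * x 2 + b 1 m * x 3) * e1 + (a 2 m * x 2 + b 2 m * x 3) * e2

theorem dvd_of_dvd_mul_adjConic [IsAlgClosed k] (h : NoZero a b)
    (hfin : FinitelyDegenerate a b) {f : Rk k}
    (hf : ∀ i, colDet (pencil a b) ∣ f * adjConic (pencil a b) i) : colDet (pencil a b) ∣ f := by
  have hmem : ∀ l : Fin 4, (∀ x : Fin 4 → k, x l ≠ 0 → (x 2, x 3) ≠ (0, 0)) →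
      X l ∈ (Ideal.span (insert (colDet (pencil a b))
        (Set.range (adjConic (pencil a b))))).radical := fun l hl => by
    refine X_mem_radical_span fun x hx => ?_
    by_cases hD : eval x (colDet (pencil a b)) = 0
    · obtain ⟨i, hi⟩ := exists_adjConic_ne_zero h hfin (hl x hx) hD
      exact ⟨_, Set.mem_insert_of_mem _ ⟨i, rfl⟩, hi⟩
    · exact ⟨_, Set.mem_insert _ _, hD⟩
  refine dvd_of_forall_dvd_mul (i := 2) (j := 3) (by decide) (hmem 2 fun x hx => by simp [hx])
    (hmem 3 fun x hx => by simp [hx]) ?_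
  rintro _ (rfl | ⟨i, rfl⟩)
  · exact dvd_mul_left _ _
  · exact hf i

end Rk

section Bihomogeneous

variable {k : Type*} [Field k]

namespace Bihom

theorem zero (m n : ℤ) : Bihom (0 : Rk k) m n := isWeightedHomogeneous_zero ..

theorem const (r : k) : Bihom (C r : Rk k) 0 0 := isWeightedHomogeneous_C ..

theorem X₀ : Bihom (X 0 : Rk k) 1 0 := isWeightedHomogeneous_X ..

theorem X₁ : Bihom (X 1 : Rk k) 1 0 := isWeightedHomogeneous_X ..

theorem X₂ : Bihom (X 2 : Rk k) 0 1 := isWeightedHomogeneous_X ..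

theorem X₃ : Bihom (X 3 : Rk k) 0 1 := isWeightedHomogeneous_X ..

variable {f g : Rk k} {m n m' n' : ℤ}

theorem add (hf : Bihom f m n) (hg : Bihom g m n) : Bihom (f + g) m n :=
  IsWeightedHomogeneous.add hf hg

theorem neg (hf : Bihom f m n) : Bihom (-f) m n :=
  Submodule.neg_mem (weightedHomogeneousSubmodule k bidegWt (m, n)) hf

theorem sub (hf : Bihom f m n) (hg : Bihom g m n) : Bihom (f - g) m n :=
  Submodule.sub_mem (weightedHomogeneousSubmodule k bidegWt (m, n)) hf hg

theorem mul (hf : Bihom f m n) (hg : Bihom g m' n') : Bihom (f * g) (m + m') (n + n') :=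
  IsWeightedHomogeneous.mul hf hg

theorem sq (hf : Bihom f m n) : Bihom (f ^ 2) (m + m) (n + n) := by
  rw [pow_two]
  exact hf.mul hf

theorem congr (hf : Bihom f m n) (hm : m = m' := by norm_num) (hn : n = n' := by norm_num) :
    Bihom f m' n' := hm ▸ hn ▸ hf

end Bihom

end Bihomogeneous

namespace Rk

variable {k : Type*} [Field k] (a b : Fin 3 → Fin 3 → k)

theorem bihom_quad (i : Fin 3) : Bihom (quad a i) 2 0 :=
  ((((Bihom.const _).mul Bihom.X₀.sq).congr.add
    ((Bihom.const _).mul (Bihom.X₀.mul Bihom.X₁)).congr).add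
      ((Bihom.const _).mul Bihom.X₁.sq).congr)

theorem bihom_pencil (j i : Fin 3) : Bihom (pencil a b j i) 0 1 :=
  ((Bihom.const _).mul Bihom.X₂).congr.add ((Bihom.const _).mul Bihom.X₃).congr

theorem bihom_biform (i : Fin 3) : Bihom (biform a b i) 2 1 :=
  (Bihom.X₂.mul (bihom_quad a i)).congr.add (Bihom.X₃.mul (bihom_quad b i)).congr

theorem bihom_cross {u v : Fin 3 → Rk k} {m n m' n' : ℤ} (hu : ∀ i, Bihom (u i) m n)
    (hv : ∀ i, Bihom (v i) m' n') (i : Fin 3) : Bihom ((u ⨯₃ v) i) (m + m') (n + n') := by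
  fin_cases i <;> exact ((hu _).mul (hv _)).sub ((hu _).mul (hv _))

theorem bihom_adjRow (j i : Fin 3) : Bihom (adjRow (pencil a b) j i) 0 2 := by
  fin_cases j <;> exact (bihom_cross (bihom_pencil a b _) (bihom_pencil a b _) i).congr

theorem bihom_adjSyz₀ (i : Fin 3) : Bihom (adjSyz₀ a b i) 1 2 :=
  (Bihom.X₁.mul (bihom_adjRow a b 0 i)).congr.sub (Bihom.X₀.mul (bihom_adjRow a b 1 i)).congr

theorem bihom_adjSyz₁ (i : Fin 3) : Bihom (adjSyz₁ a b i) 1 2 :=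
  (Bihom.X₁.mul (bihom_adjRow a b 1 i)).congr.sub (Bihom.X₀.mul (bihom_adjRow a b 2 i)).congr

theorem bihom_syz₁ (i : Fin 3) (j : Fin 6) :
    Bihom (syz₁ a b i j) ((genColDeg1 j).1 - 2) ((genColDeg1 j).2 - 1) := by
  have hg : ∀ i, Bihom ((quad a ⨯₃ quad b) i) 4 0 := fun i =>
    (bihom_cross (bihom_quad a) (bihom_quad b) i).congr
  have hp := bihom_biform a b
  have h₀ := bihom_adjSyz₀ a b
  have h₁ := bihom_adjSyz₁ a b
  fin_cases i <;> fin_cases j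
  exacts [hg _, .zero _ _, (hp _).neg, hp _, h₀ _, h₁ _,
    hg _, hp _, .zero _ _, (hp _).neg, h₀ _, h₁ _,
    hg _, (hp _).neg, hp _, .zero _ _, h₀ _, h₁ _]

theorem bihom_syz₂ (j : Fin 6) (l : Fin 5) : Bihom (syz₂ a b j l)
    ((genColDeg2 l).1 - (genColDeg1 j).1) ((genColDeg2 l).2 - (genColDeg1 j).2) := by
  have hl := bihom_pencil a b
  fin_cases j <;> fin_cases l
  exacts [.zero _ _, .zero _ _, .zero _ _, .X₃, .neg .X₂,
    hl _ _, hl _ _, hl _ _, bihom_quad _ _, bihom_quad _ _,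
    hl _ _, hl _ _, hl _ _, bihom_quad _ _, bihom_quad _ _,
    hl _ _, hl _ _, hl _ _, bihom_quad _ _, bihom_quad _ _,
    .zero _ _, .X₁, .neg .X₀, .zero _ _, .zero _ _,
    .neg .X₁, .X₀, .zero _ _, .zero _ _, .zero _ _]

theorem bihom_syz₃ (l : Fin 5) :
    Bihom (syz₃ (k := k) l 0) (6 - (genColDeg2 l).1) (3 - (genColDeg2 l).2) := by
  fin_cases l
  · exact Bihom.X₀.sq
  · exact Bihom.X₀.mul Bihom.X₁
  · exact Bihom.X₁.sq
  · exact Bihom.X₂.neg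
  · exact Bihom.X₃.neg

variable {a b}

theorem exists_eq_of_bihom {p : Rk k} (hp : Bihom p 2 1) : ∃ α β : Fin 3 → k,
    p = X 2 * (C (α 0) * X 0 ^ 2 + C (α 1) * (X 0 * X 1) + C (α 2) * X 1 ^ 2) +
      X 3 * (C (β 0) * X 0 ^ 2 + C (β 1) * (X 0 * X 1) + C (β 2) * X 1 ^ 2) := by
  induction hp using IsWeightedHomogeneous.induction_on with
  | zero => exact ⟨0, 0, by simp⟩
  | add _ _ _ _ h1 h2 =>
    obtain ⟨α, β, rfl⟩ := h1
    obtain ⟨α', β', rfl⟩ := h2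
    refine ⟨α + α', β + β', ?_⟩
    simp only [Pi.add_apply, C_add]
    ring
  | monomial d r hd =>
    have h : (d 0 : ℤ) + d 1 = 2 ∧ (d 2 : ℤ) + d 3 = 1 := by
      simp only [Finsupp.weight_apply, Finsupp.sum_fintype, zero_smul, implies_true,
        Fin.sum_univ_four] at hd
      simpa [bidegWt] using Prod.ext_iff.1 hd
    have e : (monomial d r : Rk k) = C r * (X 0 ^ d 0 * X 1 ^ d 1 * X 2 ^ d 2 * X 3 ^ d 3) := by
      rw [monomial_eq, Finsupp.prod_fintype _ _ (by simp), Fin.prod_univ_four]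
    have h01 : d 0 = 2 ∧ d 1 = 0 ∨ d 0 = 1 ∧ d 1 = 1 ∨ d 0 = 0 ∧ d 1 = 2 := by omega
    have h23 : d 2 = 1 ∧ d 3 = 0 ∨ d 2 = 0 ∧ d 3 = 1 := by omega
    rw [e]
    rcases h23 with ⟨e2, e3⟩ | ⟨e2, e3⟩ <;> rcases h01 with ⟨e0, e1⟩ | ⟨e0, e1⟩ | ⟨e0, e1⟩ <;>
      rw [e0, e1, e2, e3]
    · exact ⟨![r, 0, 0], 0, by simp; ring⟩
    · exact ⟨![0, r, 0], 0, by simp; ring⟩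
    · exact ⟨![0, 0, r], 0, by simp; ring⟩
    · exact ⟨0, ![r, 0, 0], by simp; ring⟩
    · exact ⟨0, ![0, r, 0], by simp; ring⟩
    · exact ⟨0, ![0, 0, r], by simp; ring⟩

theorem exists_eq_biform {p : Fin 3 → Rk k} (hp : ∀ i, Bihom (p i) 2 1) :
    ∃ a b : Fin 3 → Fin 3 → k, ∀ i, p i = biform a b i := by
  choose α β h using fun i => exists_eq_of_bihom (hp i)
  exact ⟨fun j i => α i j, fun j i => β i j, h⟩

theorem noZero_of_noCommonZeros
    (h : NoCommonZeros (biform a b 0) (biform a b 1) (biform a b 2)) : NoZero a b := by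
  intro x hx hx'
  have hxx : ![x 0, x 1, x 2, x 3] = x := by
    funext i
    fin_cases i <;> rfl
  have := h _ _ _ _ hx hx'
  rw [hxx] at this
  rcases this with h | h | h <;> exact ⟨_, h⟩

theorem finitelyDegenerate_of_bidegGeneric
    (h : BidegGeneric (biform a b 0) (biform a b 1) (biform a b 2)) :
    FinitelyDegenerate a b := by
  refine h.subset ?_
  rintro P ⟨c, d, hcd, e⟩
  have hsum : P.rep 0 • biform a b 0 + P.rep 1 • biform a b 1 + P.rep 2 • biform a b 2 =
      biform (fun j _ => P.rep ⬝ᵥ a j) (fun j _ => P.rep ⬝ᵥ b j) 0 := by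
    simp [biform, quad, dotProduct, Fin.sum_univ_three, smul_eq_C_mul]
    ring
  by_cases hd : d = 0
  · have hc : c ≠ 0 := fun hc => hcd (by rw [hc, hd])
    have ha : ∀ j, P.rep ⬝ᵥ a j = 0 := fun j => by simpa [hd, hc] using e j
    refine ⟨quad (fun j _ => P.rep ⬝ᵥ b j) 0, X 3, bihom_quad _ _, Bihom.X₃, ?_⟩
    rw [hsum]
    simp [biform, quad, ha]
    ring
  · have hb : ∀ j, P.rep ⬝ᵥ b j = -(d⁻¹ * c) * (P.rep ⬝ᵥ a j) := fun j => by
      field_simp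
      linear_combination e j
    refine ⟨quad (fun j _ => P.rep ⬝ᵥ a j) 0, X 2 + C (-(d⁻¹ * c)) * X 3, bihom_quad _ _,
      Bihom.X₂.add ((Bihom.const _).mul Bihom.X₃).congr, ?_⟩
    rw [hsum]
    simp only [biform, quad, hb, C_mul]
    ring

end Rk

/-- **Theorem 7.9.** In the generic case, `I = ⟨p0, p1, p2⟩` has the minimal
bigraded free resolution
`0 → R(−6,−3) → R(−4,−3)³ ⊕ R(−6,−2)² → R(−6,−1) ⊕ R(−4,−2)³ ⊕ R(−3,−3)² → R(−2,−1)³ → I → 0`,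
expressed concretely via matrices whose entries are bihomogeneous of bidegree equal to the
column bidegree minus the row bidegree (entries of a bidegree with a negative coordinate being
forced to vanish, by the convention built into `Bihom`). -/
theorem statement19 {k : Type*} [Field k] [IsAlgClosed k] (p0 p1 p2 : Rk k)
    (h0 : Bihom p0 2 1) (h1 : Bihom p1 2 1) (h2 : Bihom p2 2 1)
    (hncz : NoCommonZeros p0 p1 p2) (hgen : BidegGeneric p0 p1 p2) :
    ∃ (M1 : Matrix (Fin 3) (Fin 6) (Rk k)) (M2 : Matrix (Fin 6) (Fin 5) (Rk k))
      (M3 : Matrix (Fin 5) (Fin 1) (Rk k)),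
      (∀ (i : Fin 3) (j : Fin 6),
        Bihom (M1 i j) ((genColDeg1 j).1 - 2) ((genColDeg1 j).2 - 1)) ∧
      (∀ (j : Fin 6) (l : Fin 5),
        Bihom (M2 j l)
          ((genColDeg2 l).1 - (genColDeg1 j).1) ((genColDeg2 l).2 - (genColDeg1 j).2)) ∧
      (∀ l : Fin 5,
        Bihom (M3 l 0) (6 - (genColDeg2 l).1) (3 - (genColDeg2 l).2)) ∧
      Function.Injective (fun u : Fin 1 → Rk k => M3.mulVec u) ∧
      (∀ v : Fin 5 → Rk k, M2.mulVec v = 0 ↔ ∃ u : Fin 1 → Rk k, v = M3.mulVec u) ∧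
      (∀ v : Fin 6 → Rk k, M1.mulVec v = 0 ↔ ∃ u : Fin 5 → Rk k, v = M2.mulVec u) ∧
      (∀ A : Fin 3 → Rk k,
        A 0 * p0 + A 1 * p1 + A 2 * p2 = 0 ↔ ∃ u : Fin 6 → Rk k, A = M1.mulVec u) ∧
      (∀ r : Rk k,
        (∃ A : Fin 3 → Rk k, A 0 * p0 + A 1 * p1 + A 2 * p2 = r) ↔
          r ∈ Ideal.span ({p0, p1, p2} : Set (Rk k))) := by
  obtain ⟨a, b, hab⟩ := Rk.exists_eq_biform (p := ![p0, p1, p2]) fun i => by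
    fin_cases i
    exacts [h0, h1, h2]
  obtain rfl : p0 = Rk.biform a b 0 := hab 0
  obtain rfl : p1 = Rk.biform a b 1 := hab 1
  obtain rfl : p2 = Rk.biform a b 2 := hab 2
  have hz := Rk.noZero_of_noCommonZeros hncz
  have hfin := Rk.finitelyDegenerate_of_bidegGeneric hgen
  have hD := Rk.colDet_pencil_ne_zero hz hfin
  obtain ⟨hg0, hg1⟩ := hz.X_mem_radical
  obtain ⟨i, hg⟩ := hz.exists_cross_ne_zero
  obtain ⟨j, hp⟩ := hz.exists_biform_ne_zero
  refine ⟨Rk.syz₁ a b, Rk.syz₂ a b, Rk.syz₃, Rk.bihom_syz₁ a b, Rk.bihom_syz₂ a b,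
    Rk.bihom_syz₃, Rk.syz₃_mulVec_injective, fun v => ⟨Rk.exists_eq_syz₃_mulVec hp, ?_⟩,
    fun v => ⟨Rk.exists_eq_syz₂_mulVec hD hg0 hg1 hg, ?_⟩, fun A => ?_, fun r => ?_⟩
  · rintro ⟨u, rfl⟩
    exact Rk.syz₂_mulVec_syz₃_mulVec a b u
  · rintro ⟨u, rfl⟩
    exact Rk.syz₁_mulVec_syz₂_mulVec a b u
  · rw [← Fin.sum_univ_three fun i => A i * Rk.biform a b i]
    refine ⟨Rk.exists_eq_syz₁_mulVec hD (fun _ => Rk.dvd_of_dvd_mul_adjConic hz hfin)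
      hg0 hg1 hg, ?_⟩
    rintro ⟨u, rfl⟩
    exact Rk.sum_syz₁_mulVec_mul_biform a b u
  · rw [Ideal.span, Submodule.mem_span_triple]
    exact ⟨fun ⟨A, hA⟩ => ⟨A 0, A 1, A 2, hA⟩, fun ⟨x, y, z, h⟩ => ⟨![x, y, z], h⟩⟩
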